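/- arXiv:1808.08455 — 6 statements merged into one kernel-verified Lean document; each statement's English description precedes it below -/
import Mathlib

section
/- Let A ⊆ ℤ be a finite set of additive dimension 1, and let s be the minimum number of disjoint segments into which A can be decomposed. If s ≤ 4 and s ≤ |A| − 1, then vol(A) ≤ 2^{s−1}(|A| − s) + 1. -/
open Pointwise

/-- `A ⊆ G` and `B ⊆ G'` are Freiman isomorphic of order 2 (`F₂`-isomorphic): there is a
bijection `φ : A → B` preserving additive quadruples in both directions. -/
def F2Isomorphic {G G' : Type*} [AddCommGroup G] [AddCommGroup G']
    (A : Finset G) (B : Finset G') : Prop :=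
  ∃ φ : G → G', Set.BijOn φ (A : Set G) (B : Set G') ∧
    ∀ x ∈ A, ∀ y ∈ A, ∀ z ∈ A, ∀ t ∈ A,
      (x + y = z + t ↔ φ x + φ y = φ z + φ t)

/-- `B ⊆ ℤ^d` is not contained in any affine hyperplane of `ℤ^d`. -/
def NotInAffineHyperplane {d : ℕ} (B : Finset (Fin d → ℤ)) : Prop :=
  ∀ (c : Fin d → ℤ) (t : ℤ), (∀ x ∈ B, ∑ i, c i * x i = t) → c = 0

/-- There is a set `B ⊆ ℤ^d`, not contained in an affine hyperplane,
which is `F₂`-isomorphic to `A`. -/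
def HasFullDimWitness {G : Type*} [AddCommGroup G] (A : Finset G) (d : ℕ) : Prop :=
  ∃ B : Finset (Fin d → ℤ), F2Isomorphic A B ∧ NotInAffineHyperplane B

/-- `A` has additive dimension `d`: `d` is the largest natural number such that some
`B ⊆ ℤ^d` not contained in an affine hyperplane is `F₂`-isomorphic to `A`. -/
def HasAddDim {G : Type*} [AddCommGroup G] (A : Finset G) (d : ℕ) : Prop :=
  HasFullDimWitness A d ∧ ∀ d' : ℕ, HasFullDimWitness A d' → d' ≤ d

/-- The number of lattice points of `ℤ^d` in the convex hull of `B ⊆ ℤ^d`. -/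
noncomputable def hullCard {d : ℕ} (B : Finset (Fin d → ℤ)) : ℕ :=
  Set.ncard {x : Fin d → ℤ |
    (fun i => (x i : ℝ)) ∈ convexHull ℝ
      ((fun (v : Fin d → ℤ) (i : Fin d) => (v i : ℝ)) '' (B : Set (Fin d → ℤ)))}

/-- `A` has volume `v`: with `d = dim A`, `v` is the least number of lattice points in the
convex hull of a set `B ⊆ ℤ^d` that is `F₂`-isomorphic to `A`. -/
def HasVolume {G : Type*} [AddCommGroup G] (A : Finset G) (v : ℕ) : Prop :=
  ∃ d : ℕ, HasAddDim A d ∧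
    IsLeast {n : ℕ | ∃ B : Finset (Fin d → ℤ), F2Isomorphic A B ∧ hullCard B = n} v

/-- `v = vol(k,T,d)`, the largest volume of a finite set `A ⊆ ℕ` with `|A| = k`,
`|2A| = T` and `dim A = d`. -/
def IsMaxVolume (k T d v : ℕ) : Prop :=
  IsGreatest {n : ℕ | ∃ A : Finset ℤ, (∀ a ∈ A, 0 ≤ a) ∧ A.card = k ∧
    (A + A).card = T ∧ HasAddDim A d ∧ HasVolume A n} v

/-- `A` is extremal: `vol(A) = vol(|A|, |2A|, dim A)`. -/
def IsExtremal (A : Finset ℤ) : Prop :=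
  ∃ d v : ℕ, HasAddDim A d ∧ HasVolume A v ∧ IsMaxVolume A.card (A + A).card d v

/-- `P` is a decomposition of `A` into `s` segments: each `P i` is a nonempty integer
interval, `A` is their union, consecutive segments are separated by at least one hole
(`max Pᵢ + 1 < min Pᵢ₊₁`), and some segment has more than one element. -/
def IsSegmentDecomp (A : Finset ℤ) {s : ℕ} (P : Fin s → Finset ℤ) : Prop :=
  (∀ i, ∃ a b : ℤ, a ≤ b ∧ P i = Finset.Icc a b) ∧
  A = Finset.univ.biUnion P ∧
  (∀ i j : Fin s, i < j → ∀ x ∈ P i, ∀ y ∈ P j, x + 1 < y) ∧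
  (∃ i, 1 < (P i).card)

/-- `A` is the union of `s` segments. -/
def UnionOfSegments (A : Finset ℤ) (s : ℕ) : Prop :=
  ∃ P : Fin s → Finset ℤ, IsSegmentDecomp A P

/-- If the sums of the segments `[a i, b i] + [a j, b j]` and `[a k, b k] + [a l, b l]` meet but
`u` does not respect this relation, then `u` separates two segments at distance at most `L`, or
it fails a relation in which one pair of segments is nested inside the other. -/
theorem exists_short_gap_or_nested {n : ℕ} {a b u : Fin n → ℤ} {L : ℤ}
    (hlt : ∀ i j, i < j → b i < a j) (hL : ∀ k, b k - a k ≤ L)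
    {i j k l : Fin n} (hu : u i + u j ≠ u k + u l)
    (h₁ : a i + a j ≤ b k + b l) (h₂ : a k + a l ≤ b i + b j) :
    (∃ p q, p < q ∧ u p ≠ u q ∧ a q - b p ≤ L) ∨
      ∃ p k l q, p < k ∧ k ≤ l ∧ l < q ∧ u p + u q ≠ u k + u l ∧
        a p + a q ≤ b k + b l ∧ a k + a l ≤ b p + b q := by
  wlog hij : i ≤ j generalizing i j
  · exact this (by omega) (by omega) (by omega) (le_of_not_ge hij)
  wlog hkl : k ≤ l generalizing k l
  · exact this (by omega) (by omega) (by omega) (le_of_not_ge hkl)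
  wlog hik : i ≤ k generalizing i j k l
  · exact this (i := k) (j := l) hkl hu.symm h₂ h₁ hij (le_of_not_ge hik)
  rcases hik.eq_or_lt with rfl | hik
  · have := hL i
    rcases lt_trichotomy j l with h | rfl | h
    · exact .inl ⟨j, l, h, by omega, by omega⟩
    · exact absurd rfl hu
    · exact .inl ⟨l, j, h, by omega, by omega⟩
  · rcases lt_trichotomy j l with h | rfl | h
    · have := hlt _ _ hik
      have := hlt _ _ h
      omega
    · have := hL j
      exact .inl ⟨i, k, hik, by omega, by omega⟩
    · exact .inr ⟨i, k, l, j, hik, hkl, h, hu, h₁, h₂⟩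

/-- A set of additive dimension one that is a union of segments satisfies enough relations
between its segments to detect every nonconstant weight on the segments. -/
theorem exists_relation_of_dim_le_one {A : Finset ℤ} {n : ℕ} {a b : Fin n → ℤ}
    (hab : ∀ i, a i ≤ b i) (hlt : ∀ i j, i < j → b i < a j)
    (hA : ∀ x, x ∈ A ↔ ∃ i, a i ≤ x ∧ x ≤ b i) (hne : ∃ i, a i < b i)
    (hd : ∀ d, HasFullDimWitness A d → d ≤ 1) {u : Fin n → ℤ} {p q : Fin n} (hpq : u p ≠ u q) :
    ∃ i j k l, u i + u j ≠ u k + u l ∧ a i + a j ≤ b k + b l ∧ a k + a l ≤ b i + b j := by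
  classical
  by_contra! hcon
  obtain ⟨i₀, hi₀⟩ := hne
  have : Nonempty (Fin n) := ⟨p⟩
  choose! f hf using fun x => (hA x).1
  have hf_eq : ∀ i x, a i ≤ x → x ≤ b i → f x = i := by
    intro i x h₁ h₂
    have h := hf x ((hA x).2 ⟨i, h₁, h₂⟩)
    rcases lt_trichotomy (f x) i with h' | h' | h'
    · have := hlt _ _ h'; omega
    · exact h'
    · have := hlt _ _ h'; omega
  let φ : ℤ → Fin 2 → ℤ := fun x => ![x, u (f x)]
  have hφ : Function.Injective φ := fun x y h => congrFun h 0
  refine absurd (hd 2 ⟨A.image φ, ⟨φ, ?_, ?_⟩, ?_⟩) (by norm_num)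
  · simpa using hφ.injOn.bijOn_image (s := (A : Set ℤ))
  · intro x hx y hy z hz t ht
    constructor
    · intro h
      have hx := hf x hx
      have hy := hf y hy
      have hz := hf z hz
      have ht := hf t ht
      have key : u (f x) + u (f y) = u (f z) + u (f t) := by
        by_contra hne
        have := hcon _ _ _ _ hne (by omega)
        omega
      ext i
      fin_cases i
      · exact h
      · exact key
    · exact fun h => congrFun h 0
  · intro c t h
    have key : ∀ i x, a i ≤ x → x ≤ b i → c 0 * x + c 1 * u i = t := by
      intro i x h₁ h₂
      have := h (φ x) (Finset.mem_image_of_mem _ ((hA x).2 ⟨i, h₁, h₂⟩))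
      simpa [φ, Fin.sum_univ_two, hf_eq i x h₁ h₂] using this
    have h₀ : c 0 = 0 := by
      have h₁ := key i₀ (a i₀) le_rfl hi₀.le
      have h₂ := key i₀ (a i₀ + 1) (by omega) (by omega)
      linarith
    have h₁ : c 1 = 0 := by
      have h₁ := key p (a p) le_rfl (hab p)
      have h₂ := key q (a q) le_rfl (hab q)
      have h₃ : c 1 * (u p - u q) = 0 := by rw [h₀] at h₁ h₂; linarith
      exact (mul_eq_zero.1 h₃).resolve_right (sub_ne_zero.2 hpq)
    ext i
    fin_cases i
    · exact h₀
    · exact h₁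

/-- A one-dimensional set of integers between `m` and `M` has volume at most `M + 1 - m`. -/
theorem volume_le_of_subset_Icc {A : Finset ℤ} {m M : ℤ} (hd : HasAddDim A 1)
    (hA : ∀ x ∈ A, m ≤ x ∧ x ≤ M) {v : ℕ} (hv : HasVolume A v) : v ≤ (M + 1 - m).toNat := by
  classical
  obtain ⟨d, hd', -, hv⟩ := hv
  obtain rfl : d = 1 := le_antisymm (hd.2 _ hd'.1) (hd'.2 _ hd.1)
  let φ : ℤ → Fin 1 → ℤ := fun x _ => x
  have hφ : Function.Injective φ := fun x y h => congrFun h 0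
  have hiso : F2Isomorphic A (A.image φ) := by
    refine ⟨φ, by simpa using hφ.injOn.bijOn_image (s := (A : Set ℤ)), fun x _ y _ z _ t _ => ?_⟩
    exact ⟨fun h => funext fun _ => h, fun h => congrFun h 0⟩
  refine (hv ⟨_, hiso, rfl⟩).trans ?_
  rw [← Int.card_Icc, ← Set.ncard_coe_finset]
  refine Set.ncard_le_ncard_of_injOn (fun x => x 0) ?_ ?_ (Finset.finite_toSet _)
  · intro x hx
    have hconv : Convex ℝ {f : Fin 1 → ℝ | (m : ℝ) ≤ f 0 ∧ f 0 ≤ M} :=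
      (convex_Icc (m : ℝ) M).is_linear_preimage (LinearMap.proj (R := ℝ) 0).isLinear
    have := convexHull_min (t := {f : Fin 1 → ℝ | (m : ℝ) ≤ f 0 ∧ f 0 ≤ M}) ?_ hconv hx
    · simpa using this
    · rintro _ ⟨y, hy, rfl⟩
      obtain ⟨z, hz, rfl⟩ := Finset.mem_image.1 (Finset.mem_coe.1 hy)
      have := hA z hz
      simpa [φ] using this
  · intro x _ y _ h
    ext i
    rw [Subsingleton.elim i 0]
    exact h

/-- The diameter bound for two segments. -/
theorem diam_le_two {a b : Fin 2 → ℤ} {L : ℤ} (hL : ∑ i, (b i - a i) = L)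
    (H : ∀ u : Fin 2 → ℤ, (∃ p q, u p ≠ u q) →
      (∃ p q, p < q ∧ u p ≠ u q ∧ a q - b p ≤ L) ∨
      ∃ p k l q, p < k ∧ k ≤ l ∧ l < q ∧ u p + u q ≠ u k + u l ∧
        a p + a q ≤ b k + b l ∧ a k + a l ≤ b p + b q) :
    b 1 - a 0 ≤ 2 * L := by
  have := H ![0, 1] ⟨0, 1, by simp⟩
  simp [Fin.exists_fin_two] at this
  simp [Fin.sum_univ_two] at hL
  omega

/-- The diameter bound for three segments. -/
theorem diam_le_three {a b : Fin 3 → ℤ} {L : ℤ}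
    (hab : ∀ i, a i ≤ b i) (hlt : ∀ i j, i < j → b i < a j) (hL : ∑ i, (b i - a i) = L)
    (H : ∀ u : Fin 3 → ℤ, (∃ p q, u p ≠ u q) →
      (∃ p q, p < q ∧ u p ≠ u q ∧ a q - b p ≤ L) ∨
      ∃ p k l q, p < k ∧ k ≤ l ∧ l < q ∧ u p + u q ≠ u k + u l ∧
        a p + a q ≤ b k + b l ∧ a k + a l ≤ b p + b q) :
    b 2 - a 0 ≤ 4 * L := by
  have h₁ := H ![0, 1, 1] ⟨0, 1, by simp⟩
  have h₂ := H ![0, 0, 1] ⟨0, 2, by simp⟩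
  have h₃ := H ![0, 1, 2] ⟨0, 1, by simp⟩
  simp [Fin.exists_fin_succ] at h₁ h₂ h₃
  simp [Fin.sum_univ_succ] at hL
  have := hab 0
  have := hab 1
  have := hab 2
  have := hlt 0 1 (by decide)
  have := hlt 1 2 (by decide)
  omega

/-- The diameter bound for four segments. -/
theorem diam_le_four {a b : Fin 4 → ℤ} {L : ℤ}
    (hab : ∀ i, a i ≤ b i) (hlt : ∀ i j, i < j → b i < a j) (hL : ∑ i, (b i - a i) = L)
    (H : ∀ u : Fin 4 → ℤ, (∃ p q, u p ≠ u q) →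
      (∃ p q, p < q ∧ u p ≠ u q ∧ a q - b p ≤ L) ∨
      ∃ p k l q, p < k ∧ k ≤ l ∧ l < q ∧ u p + u q ≠ u k + u l ∧
        a p + a q ≤ b k + b l ∧ a k + a l ≤ b p + b q) :
    b 3 - a 0 ≤ 8 * L := by
  have := hlt 0 1 (by decide)
  have := hlt 1 2 (by decide)
  have := hlt 2 3 (by decide)
  have := hab 0
  have := hab 1
  have := hab 2
  have := hab 3
  simp [Fin.sum_univ_succ] at hL
  have K : ∀ x y z : ℤ, (x ≠ 0 ∨ y ≠ 0 ∨ z ≠ 0) →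
      (x ≠ 0 ∧ a 1 - b 0 ≤ L) ∨ (y ≠ 0 ∧ a 2 - b 1 ≤ L) ∨ (z ≠ 0 ∧ a 3 - b 2 ≤ L) ∨
      (x ≠ y ∧ a 0 + a 2 ≤ b 1 + b 1 ∧ a 1 + a 1 ≤ b 0 + b 2) ∨
      (y ≠ z ∧ a 1 + a 3 ≤ b 2 + b 2 ∧ a 2 + a 2 ≤ b 1 + b 3) ∨
      (x ≠ z ∧ a 0 + a 3 ≤ b 1 + b 2 ∧ a 1 + a 2 ≤ b 0 + b 3) ∨
      (x ≠ y + z ∧ a 0 + a 3 ≤ b 1 + b 1 ∧ a 1 + a 1 ≤ b 0 + b 3) ∨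
      (x + y ≠ z ∧ a 0 + a 3 ≤ b 2 + b 2 ∧ a 2 + a 2 ≤ b 0 + b 3) := by
    intro x y z h
    have h := H ![0, x, x + y, x + y + z] (by simp [Fin.exists_fin_succ]; omega)
    simp [Fin.exists_fin_succ] at h
    rcases h with h | h
    · have : (x ≠ 0 ∧ a 1 - b 0 ≤ L) ∨ (y ≠ 0 ∧ a 2 - b 1 ≤ L) ∨ (z ≠ 0 ∧ a 3 - b 2 ≤ L) := by
        rcases h with (h | h | h) | (h | h) | h <;> omega
      rcases this with h | h | h
      · exact .inl h
      · exact .inr (.inl h)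
      · exact .inr (.inr (.inl h))
    · refine .inr (.inr (.inr ?_))
      rcases h with (((h | h) | h) | h) | h <;> omega
  have t001 := K 0 0 1 (by simp)
  have t01m := K 0 1 (-1) (by simp)
  have t010 := K 0 1 0 (by simp)
  have t011 := K 0 1 1 (by simp)
  have t1m0 := K 1 (-1) 0 (by simp)
  have t100 := K 1 0 0 (by simp)
  have t101 := K 1 0 1 (by simp)
  have t110 := K 1 1 0 (by simp)
  have t111 := K 1 1 1 (by simp)
  have t112 := K 1 1 2 (by simp)
  have t211 := K 2 1 1 (by simp)
  norm_num at t001 t01m t010 t011 t1m0 t100 t101 t110 t111 t112 t211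
  rcases t101 with h | h | ⟨h, h'⟩ | ⟨h, h'⟩
  · rcases t001 with h | ⟨h, h'⟩ | ⟨h, h'⟩ | ⟨h, h'⟩ | ⟨h, h'⟩
    · rcases t010 with h | ⟨h, h'⟩ | ⟨h, h'⟩ | ⟨h, h'⟩ | ⟨h, h'⟩ <;> linarith
    · rcases t011 with h | h | ⟨h, h'⟩ | ⟨h, h'⟩ | ⟨h, h'⟩ <;> linarith
    · rcases t010 with h | ⟨h, h'⟩ | ⟨h, h'⟩ | ⟨h, h'⟩ | ⟨h, h'⟩ <;> linarith
    · rcases t01m with h | h | ⟨h, h'⟩ | ⟨h, h'⟩ | ⟨h, h'⟩ | ⟨h, h'⟩ <;> linarith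
    · rcases t011 with h | h | ⟨h, h'⟩ | ⟨h, h'⟩ | ⟨h, h'⟩ <;> linarith
  · rcases t010 with h | ⟨h, h'⟩ | ⟨h, h'⟩ | ⟨h, h'⟩ | ⟨h, h'⟩
    · rcases t100 with h | ⟨h, h'⟩ | ⟨h, h'⟩ | ⟨h, h'⟩ | ⟨h, h'⟩ <;> linarith
    · rcases t110 with h | h | ⟨h, h'⟩ | ⟨h, h'⟩ | ⟨h, h'⟩ <;> linarith
    · rcases t100 with h | ⟨h, h'⟩ | ⟨h, h'⟩ | ⟨h, h'⟩ | ⟨h, h'⟩ <;> linarith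
    · rcases t110 with h | h | ⟨h, h'⟩ | ⟨h, h'⟩ | ⟨h, h'⟩ <;> linarith
    · rcases t1m0 with h | h | ⟨h, h'⟩ | ⟨h, h'⟩ | ⟨h, h'⟩ | ⟨h, h'⟩ <;> linarith
  · rcases t001 with h | ⟨h, h'⟩ | ⟨h, h'⟩ | ⟨h, h'⟩ | ⟨h, h'⟩
    · rcases t110 with h | h | ⟨h, h'⟩ | ⟨h, h'⟩ | ⟨h, h'⟩ <;> linarith
    · rcases t111 with h | h | h | ⟨h, h'⟩ | ⟨h, h'⟩ <;> linarith
    · rcases t111 with h | h | h | ⟨h, h'⟩ | ⟨h, h'⟩ <;> linarith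
    · rcases t110 with h | h | ⟨h, h'⟩ | ⟨h, h'⟩ | ⟨h, h'⟩ <;> linarith
    · rcases t112 with h | h | h | ⟨h, h'⟩ | ⟨h, h'⟩ | ⟨h, h'⟩ <;> linarith
  · rcases t011 with h | h | ⟨h, h'⟩ | ⟨h, h'⟩ | ⟨h, h'⟩
    · rcases t100 with h | ⟨h, h'⟩ | ⟨h, h'⟩ | ⟨h, h'⟩ | ⟨h, h'⟩ <;> linarith
    · rcases t100 with h | ⟨h, h'⟩ | ⟨h, h'⟩ | ⟨h, h'⟩ | ⟨h, h'⟩ <;> linarith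
    · rcases t111 with h | h | h | ⟨h, h'⟩ | ⟨h, h'⟩ <;> linarith
    · rcases t111 with h | h | h | ⟨h, h'⟩ | ⟨h, h'⟩ <;> linarith
    · rcases t211 with h | h | h | ⟨h, h'⟩ | ⟨h, h'⟩ | ⟨h, h'⟩ <;> linarith

/-- Proposition 1.4: Conjecture 1.2 holds for `s ≤ 4`. -/
theorem volume_bound_few_segments (A : Finset ℤ) (hd : HasAddDim A 1) (s : ℕ)
    (hs : IsLeast {t : ℕ | UnionOfSegments A t} s)
    (hs4 : s ≤ 4) (hsk : s + 1 ≤ A.card)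
    (v : ℕ) (hv : HasVolume A v) :
    v ≤ 2 ^ (s - 1) * (A.card - s) + 1 := by
  obtain ⟨P, hP, hAP, hsep, i₀, hi₀⟩ := hs.1
  choose a b hab hPab using hP
  obtain rfl : P = fun i => Finset.Icc (a i) (b i) := funext hPab
  have hlt : ∀ i j, i < j → b i < a j := fun i j h => by
    have := hsep i j h (b i) (by simp [hab]) (a j) (by simp [hab])
    omega
  have hA : ∀ x, x ∈ A ↔ ∃ i, a i ≤ x ∧ x ≤ b i := by simp [hAP]
  have hne : ∃ i, a i < b i := ⟨i₀, by rw [Int.card_Icc] at hi₀; omega⟩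
  have hcard : ∑ i, (b i - a i) = (A.card - s : ℕ) := by
    rw [Nat.cast_sub (by omega), hAP, Finset.card_biUnion]
    · have (i : Fin s) : ((b i + 1 - a i).toNat : ℤ) = b i - a i + 1 := by
        have := hab i
        omega
      simp [Int.card_Icc, this, Finset.sum_add_distrib]
    · intro i _ j _ hij
      rw [Function.onFun, Finset.disjoint_left]
      intro x hi hj
      simp only [Finset.mem_Icc] at hi hj
      rcases lt_or_gt_of_ne hij with h | h
      · have := hlt _ _ h; omega
      · have := hlt _ _ h; omega
  set L := A.card - s with hLdef
  have hL : ∀ k, b k - a k ≤ L := fun k => hcard ▸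
    Finset.single_le_sum (f := fun i => b i - a i) (fun i _ => by have := hab i; omega)
      (Finset.mem_univ k)
  have H : ∀ u : Fin s → ℤ, (∃ p q, u p ≠ u q) →
      (∃ p q, p < q ∧ u p ≠ u q ∧ a q - b p ≤ L) ∨
      ∃ p k l q, p < k ∧ k ≤ l ∧ l < q ∧ u p + u q ≠ u k + u l ∧
        a p + a q ≤ b k + b l ∧ a k + a l ≤ b p + b q := by
    rintro u ⟨p, q, hpq⟩
    obtain ⟨i, j, k, l, hu, h₁, h₂⟩ := exists_relation_of_dim_le_one hab hlt hA hne hd.2 hpq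
    exact exists_short_gap_or_nested hlt hL hu h₁ h₂
  have hs0 : 0 < s := i₀.pos
  suffices b ⟨s - 1, by omega⟩ - a ⟨0, hs0⟩ ≤ 2 ^ (s - 1) * (L : ℤ) by
    have hbd : ∀ x ∈ A, a ⟨0, hs0⟩ ≤ x ∧ x ≤ b ⟨s - 1, by omega⟩ := by
      intro x hx
      obtain ⟨i, h₁, h₂⟩ := (hA x).1 hx
      constructor
      · rcases (show ⟨0, hs0⟩ ≤ i from Nat.zero_le _).eq_or_lt with h | h
        · rwa [h]
        · have := hlt _ _ h
          have := hab ⟨0, hs0⟩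
          omega
      · rcases (show i ≤ ⟨s - 1, by omega⟩ from Nat.le_sub_one_of_lt i.2).eq_or_lt with h | h
        · rwa [← h]
        · have := hlt _ _ h
          have := hab ⟨s - 1, by omega⟩
          omega
    obtain ⟨x, hx⟩ := Finset.card_pos.1 (by omega : 0 < A.card)
    have := hbd x hx
    refine (volume_le_of_subset_Icc hd hbd hv).trans ?_
    zify
    rw [Int.toNat_of_nonneg (by omega)]
    linarith
  clear_value L
  interval_cases s
  · simpa using hcard.le
  · simpa using diam_le_two hcard H
  · simpa using diam_le_three hab hlt hcard H
  · simpa using diam_le_four hab hlt hcard H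
end

section
/- Let A ⊆ ℤ be the union of s disjoint segments P₁, …, P_s with 1 ≤ s ≤ |A| − 1. Let S_A be the matrix with s columns whose rows are all vectors e_{j₁} + e_{j₂} − e_{j₃} − e_{j₄} ∈ ℤ^s such that (P_{j₁} + P_{j₂}) ∩ (P_{j₃} + P_{j₄}) ≠ ∅ and not j₁ = j₂ = j₃ = j₄. Then dim(A) = s − rank(S_A), where rank denotes the rank of the matrix over ℚ. -/
open Pointwise

/-- The rank over `ℚ` of the matrix `S_A` whose rows are the vectors
`e_{j₁} + e_{j₂} - e_{j₃} - e_{j₄}` for which `(P_{j₁} + P_{j₂}) ∩ (P_{j₃} + P_{j₄}) ≠ ∅`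
and not `j₁ = j₂ = j₃ = j₄`, computed as the dimension of the row span. -/
noncomputable def segRank {s : ℕ} (P : Fin s → Finset ℤ) : ℕ :=
  Module.finrank ℚ (Submodule.span ℚ
    {v : Fin s → ℚ | ∃ j₁ j₂ j₃ j₄ : Fin s,
      ¬(j₁ = j₂ ∧ j₁ = j₃ ∧ j₁ = j₄) ∧
      ((P j₁ + P j₂) ∩ (P j₃ + P j₄)).Nonempty ∧
      v = Pi.single j₁ 1 + Pi.single j₂ 1 - Pi.single j₃ 1 - Pi.single j₄ 1})

/-- If `ψ : A → V` is a spanning Freiman homomorphism of order 2 that vanishes at a point of `A`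
and through which every `ℚ`-valued Freiman homomorphism factors up to a constant, then the
additive dimension of `A` is the dimension of `V`. -/
theorem HasAddDim.of_universal {A : Finset ℤ} {V : Type*} [AddCommGroup V] [Module ℚ V]
    [FiniteDimensional ℚ V] (ψ : ℤ → V) {a₀ : ℤ} (ha₀ : a₀ ∈ A) (hψ₀ : ψ a₀ = 0)
    (hspan : Submodule.span ℚ (ψ '' (A : Set ℤ)) = ⊤)
    (hom : ∀ x ∈ A, ∀ y ∈ A, ∀ z ∈ A, ∀ t ∈ A, x + y = z + t → ψ x + ψ y = ψ z + ψ t)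
    (huniv : ∀ g : ℤ → ℚ,
      (∀ x ∈ A, ∀ y ∈ A, ∀ z ∈ A, ∀ t ∈ A, x + y = z + t → g x + g y = g z + g t) →
      ∃ l : Module.Dual ℚ V, ∀ x ∈ A, g x = g a₀ + l (ψ x)) :
    HasAddDim A (Module.finrank ℚ V) := by
  constructor
  · let b := Module.finBasis ℚ V
    obtain ⟨N, hN⟩ := IsLocalization.exist_integer_multiples_of_finite (nonZeroDivisors ℤ)
      (fun p : A × Fin (Module.finrank ℚ V) => b.repr (ψ p.1) p.2)
    have hN0 : ((N : ℤ) : ℚ) ≠ 0 := by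
      exact_mod_cast nonZeroDivisors.coe_ne_zero N
    have hex : ∀ x k, ∃ m : ℤ, x ∈ A → (m : ℚ) = (N : ℤ) * b.repr (ψ x) k := by
      intro x k
      by_cases hx : x ∈ A
      · obtain ⟨m, hm⟩ := hN (⟨x, hx⟩, k)
        exact ⟨m, fun _ => by simpa [zsmul_eq_mul] using hm⟩
      · exact ⟨0, fun h => absurd h hx⟩
    choose φ hφ using hex
    obtain ⟨l, hl⟩ := huniv (fun x => (x : ℚ)) (by
      intro x _ y _ z _ t _ h
      exact_mod_cast h)
    have hiso : ∀ x ∈ A, ∀ y ∈ A, ∀ z ∈ A, ∀ t ∈ A,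
        (x + y = z + t ↔ φ x + φ y = φ z + φ t) := by
      intro x hx y hy z hz t ht
      constructor
      · intro h
        have h' := hom x hx y hy z hz t ht h
        funext k
        have hk : b.repr (ψ x) k + b.repr (ψ y) k = b.repr (ψ z) k + b.repr (ψ t) k := by
          have := congrArg (fun v => b.repr v k) h'
          simpa using this
        have : ((φ x k + φ y k : ℤ) : ℚ) = ((φ z k + φ t k : ℤ) : ℚ) := by
          push_cast
          rw [hφ x k hx, hφ y k hy, hφ z k hz, hφ t k ht, ← mul_add, ← mul_add, hk]
        exact_mod_cast this
      · intro h
        have h' : ψ x + ψ y = ψ z + ψ t := by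
          apply b.repr.injective
          ext k
          have hk : φ x k + φ y k = φ z k + φ t k := congrFun h k
          have hk' : ((φ x k + φ y k : ℤ) : ℚ) = ((φ z k + φ t k : ℤ) : ℚ) := by rw [hk]
          push_cast at hk'
          rw [hφ x k hx, hφ y k hy, hφ z k hz, hφ t k ht, ← mul_add, ← mul_add] at hk'
          simpa using mul_left_cancel₀ hN0 hk'
        have h'' := congrArg l h'
        rw [map_add, map_add] at h''
        have : (x : ℚ) + y = z + t := by
          linarith [hl x hx, hl y hy, hl z hz, hl t ht]
        exact_mod_cast this
    refine ⟨A.image φ, ⟨φ, ?_, hiso⟩, ?_⟩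
    · rw [Finset.coe_image]
      refine Set.InjOn.bijOn_image fun x hx y hy h => ?_
      have := (hiso x hx x hx y hy x hx).2 (by rw [h])
      omega
    · intro c t hc
      have hc' : ∀ x ∈ A, ∑ k, c k * φ x k = t := fun x hx =>
        hc _ (Finset.mem_image_of_mem φ hx)
      let f : Module.Dual ℚ V := ∑ k, (c k : ℚ) • b.coord k
      have hf : ∀ x ∈ A, (N : ℤ) * f (ψ x) = (t : ℚ) := by
        intro x hx
        rw [← hc' x hx]
        push_cast
        simp only [f, LinearMap.sum_apply, LinearMap.smul_apply, Module.Basis.coord_apply,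
          smul_eq_mul, Finset.mul_sum]
        refine Finset.sum_congr rfl fun k _ => ?_
        rw [hφ x k hx]
        ring
      have ht : (t : ℚ) = 0 := by
        rw [← hf a₀ ha₀, hψ₀, map_zero, mul_zero]
      have hf0 : f = 0 := by
        refine LinearMap.ext_on hspan ?_
        rintro _ ⟨x, hx, rfl⟩
        have := hf x hx
        rw [ht] at this
        simpa using (mul_eq_zero.1 this).resolve_left hN0
      funext k
      have := congrArg (fun f : Module.Dual ℚ V => f (b k)) hf0
      simpa [f, Module.Basis.coord_apply, Finsupp.single_apply] using this
  · rintro d ⟨B, ⟨φ, hbij, hiso⟩, hB⟩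
    have hex : ∀ k : Fin d, ∃ l : Module.Dual ℚ V,
        ∀ x ∈ A, (φ x k : ℚ) = φ a₀ k + l (ψ x) := by
      intro k
      refine huniv (fun x => (φ x k : ℚ)) ?_
      intro x hx y hy z hz t ht h
      exact_mod_cast congrFun ((hiso x hx y hy z hz t ht).1 h) k
    choose l hl using hex
    have hli : LinearIndependent ℤ l := by
      rw [Fintype.linearIndependent_iff]
      intro c hc
      refine congrFun (hB c (∑ k, c k * φ a₀ k) ?_)
      intro v hv
      obtain ⟨x, hx, rfl⟩ := hbij.surjOn hv
      have h0 := congrArg (fun f : Module.Dual ℚ V => f (ψ x)) hc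
      simp only [LinearMap.sum_apply, LinearMap.smul_apply, LinearMap.zero_apply,
        zsmul_eq_mul] at h0
      have : ∑ k, (c k : ℚ) * φ x k = ∑ k, (c k : ℚ) * φ a₀ k := by
        simp only [hl _ x hx, mul_add, Finset.sum_add_distrib, h0, add_zero]
      exact_mod_cast this
    have hliQ : LinearIndependent ℚ l := (LinearIndependent.iff_fractionRing ℤ ℚ).1 hli
    simpa [Subspace.dual_finrank_eq] using hliQ.fintype_card_le_finrank

/-- A Freiman homomorphism of order 2 on a set containing `a₀` and `a₀ + 1` is affine with slope
`g (a₀ + 1) - g a₀` on every interval contained in the set. -/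
theorem freimanHom_affine_on_Icc {A : Finset ℤ} {g : ℤ → ℚ}
    (hg : ∀ x ∈ A, ∀ y ∈ A, ∀ z ∈ A, ∀ t ∈ A, x + y = z + t → g x + g y = g z + g t)
    {a₀ : ℤ} (ha₀ : a₀ ∈ A) (ha₁ : a₀ + 1 ∈ A) {a b : ℤ} (hab : Finset.Icc a b ⊆ A) {x : ℤ}
    (hx : x ∈ Finset.Icc a b) : g x = g a + (g (a₀ + 1) - g a₀) * (x - a) := by
  obtain ⟨hax, hxb⟩ := Finset.mem_Icc.1 hx
  clear hx
  induction x, hax using Int.leInduction with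
  | base => simp
  | succ x hax ih =>
    have h := hg (x + 1) (hab (Finset.mem_Icc.2 ⟨by omega, hxb⟩)) a₀ ha₀ x
      (hab (Finset.mem_Icc.2 ⟨hax, by omega⟩)) (a₀ + 1) ha₁ (by ring)
    have := ih (by omega)
    push_cast
    linarith

/-- Corollary 2.2: `dim(A) = s - rank(S_A)` for a union of `s` disjoint segments. -/
theorem dim_eq_sub_segRank (A : Finset ℤ) (s : ℕ) (P : Fin s → Finset ℤ)
    (h1 : 1 ≤ s) (hsk : s + 1 ≤ A.card)
    (hP : IsSegmentDecomp A P) :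
    HasAddDim A (s - segRank P) := by
  obtain ⟨hI, hA, hsep, i₀, hi₀⟩ := hP
  choose a b hab hPi using hI
  have haP : ∀ i, a i ∈ P i := fun i => by
    rw [hPi]
    exact Finset.left_mem_Icc.2 (hab i)
  have hPA : ∀ i, P i ⊆ A := fun i => by
    rw [hA]
    exact Finset.subset_biUnion_of_mem P (Finset.mem_univ i)
  have hmem : ∀ x ∈ A, ∃ i, x ∈ P i := fun x hx => by simpa [hA] using hx
  have huniq : ∀ x i j, x ∈ P i → x ∈ P j → i = j := by
    intro x i j hi hj
    rcases lt_trichotomy i j with h | h | h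
    · have := hsep i j h x hi x hj
      omega
    · exact h
    · have := hsep j i h x hj x hi
      omega
  obtain ⟨idx, hidx⟩ : ∃ idx : ℤ → Fin s, ∀ x i, x ∈ P i → idx x = i := by
    have : ∀ x, ∃ j, ∀ i, x ∈ P i → j = i := by
      intro x
      by_cases h : ∃ i, x ∈ P i
      · obtain ⟨j, hj⟩ := h
        exact ⟨j, fun i hi => huniq x j i hj hi⟩
      · exact ⟨i₀, fun i hi => absurd ⟨i, hi⟩ h⟩
    choose idx hidx using this
    exact ⟨idx, hidx⟩
  set a₀ := a i₀ with ha₀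
  have ha₁P : a₀ + 1 ∈ P i₀ := by
    rw [hPi, Int.card_Icc] at hi₀
    rw [hPi, Finset.mem_Icc]
    omega
  have ha₀A : a₀ ∈ A := hPA _ (haP i₀)
  have ha₁A : a₀ + 1 ∈ A := hPA _ ha₁P
  set R : Set (Fin s → ℚ) := {v : Fin s → ℚ | ∃ j₁ j₂ j₃ j₄ : Fin s,
      ¬(j₁ = j₂ ∧ j₁ = j₃ ∧ j₁ = j₄) ∧
      ((P j₁ + P j₂) ∩ (P j₃ + P j₄)).Nonempty ∧
      v = Pi.single j₁ 1 + Pi.single j₂ 1 - Pi.single j₃ 1 - Pi.single j₄ 1} with hR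
  set W := Submodule.span ℚ R with hW
  have hdim : s - segRank P = Module.finrank ℚ ((Fin s → ℚ) ⧸ W) := by
    have := W.finrank_quotient_add_finrank
    rw [Module.finrank_fin_fun] at this
    change s - Module.finrank ℚ W = _
    omega
  rw [hdim]
  let e : Fin s → (Fin s → ℚ) := fun j => Pi.single j 1
  let q : Fin s → (Fin s → ℚ) ⧸ W := fun j => W.mkQ (e j)
  have hq : Submodule.span ℚ (Set.range q) = ⊤ := by
    have he : Submodule.span ℚ (Set.range e) = ⊤ := by
      have := (Pi.basisFun ℚ (Fin s)).span_eq
      convert this using 3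
      funext j
      simp [e]
    have : Set.range q = W.mkQ '' Set.range e := by
      rw [← Set.range_comp]
      rfl
    rw [this, Submodule.span_image, he, Submodule.map_top, Submodule.range_mkQ]
  let ψ : ℤ → (Fin s → ℚ) ⧸ W := fun x => q (idx x) + ((x : ℚ) - a₀ - 1) • q i₀
  have hψ : ∀ i, ∀ x ∈ P i, ψ x = q i + ((x : ℚ) - a₀ - 1) • q i₀ := by
    intro i x hx
    simp only [ψ, hidx x i hx]
  refine HasAddDim.of_universal ψ ha₀A ?_ ?_ ?_ ?_
  · rw [hψ i₀ a₀ (haP i₀)]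
    module
  · rw [eq_top_iff, ← hq, Submodule.span_le]
    have hmemψ : ∀ i, ∀ x ∈ P i, ψ x ∈ Submodule.span ℚ (ψ '' (A : Set ℤ)) :=
      fun i x hx => Submodule.subset_span ⟨x, hPA i hx, rfl⟩
    have hq₀ : q i₀ ∈ Submodule.span ℚ (ψ '' (A : Set ℤ)) := by
      have h := hmemψ i₀ _ ha₁P
      rw [hψ i₀ _ ha₁P] at h
      simpa using h
    rintro _ ⟨j, rfl⟩
    have h := Submodule.sub_mem _ (hmemψ j _ (haP j))
      (Submodule.smul_mem _ ((a j : ℚ) - a₀ - 1) hq₀)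
    rw [hψ j _ (haP j)] at h
    simpa using h
  · intro x hx y hy z hz t ht hsum
    obtain ⟨i, hi⟩ := hmem x hx
    obtain ⟨j, hj⟩ := hmem y hy
    obtain ⟨k, hk⟩ := hmem z hz
    obtain ⟨m, hm⟩ := hmem t ht
    have hrel : q i + q j - q k - q m = 0 := by
      by_cases hall : i = j ∧ i = k ∧ i = m
      · obtain ⟨rfl, rfl, rfl⟩ := hall
        module
      · simp only [q, ← map_add, ← map_sub]
        rw [Submodule.mkQ_apply, Submodule.Quotient.mk_eq_zero]
        refine Submodule.subset_span ⟨i, j, k, m, hall, ⟨x + y, ?_⟩, rfl⟩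
        refine Finset.mem_inter.2 ⟨Finset.add_mem_add hi hj, ?_⟩
        rw [hsum]
        exact Finset.add_mem_add hk hm
    have hsumQ : (x : ℚ) = z + t - y := by
      rw [eq_sub_iff_add_eq]
      exact_mod_cast hsum
    rw [hψ i x hi, hψ j y hj, hψ k z hk, hψ m t hm, hsumQ, ← sub_eq_zero, ← hrel]
    module
  · intro g hg
    set δ := g (a₀ + 1) - g a₀ with hδ
    have haff : ∀ i, ∀ x ∈ P i, g x = g (a i) + δ * (x - a i) := by
      intro i x hx
      refine freimanHom_affine_on_Icc hg ha₀A ha₁A (b := b i) ?_ ?_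
      · rw [← hPi]
        exact hPA i
      · rwa [← hPi]
    let c : Fin s → ℚ := fun i => g (a i) - g a₀ - δ * (a i - a₀ - 1)
    have hc : ∀ i, ∀ x ∈ P i, g x = g a₀ + c i + δ * (x - a₀ - 1) := by
      intro i x hx
      rw [haff i x hx]
      simp only [c]
      ring
    let f : Module.Dual ℚ (Fin s → ℚ) := (Pi.basisFun ℚ (Fin s)).constr ℚ c
    have hf : ∀ j, f (e j) = c j := by
      intro j
      have := (Pi.basisFun ℚ (Fin s)).constr_basis ℚ c j
      simpa [f, e] using this
    have hfW : W ≤ LinearMap.ker f := by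
      rw [hW, Submodule.span_le]
      rintro _ ⟨i, j, k, m, -, ⟨w, hw⟩, rfl⟩
      obtain ⟨hw₁, hw₂⟩ := Finset.mem_inter.1 hw
      obtain ⟨x, hx, y, hy, hxy⟩ := Finset.mem_add.1 hw₁
      obtain ⟨z, hz, t, ht, hzt⟩ := Finset.mem_add.1 hw₂
      have hsum : x + y = z + t := hxy.trans hzt.symm
      have hsumQ : (x : ℚ) + y = z + t := by exact_mod_cast hsum
      have h := hg x (hPA i hx) y (hPA j hy) z (hPA k hz) t (hPA m ht) hsum
      rw [hc i x hx, hc j y hy, hc k z hz, hc m t ht] at h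
      change f (e i + e j - e k - e m) = 0
      rw [map_sub, map_sub, map_add, hf, hf, hf, hf]
      linear_combination h - δ * hsumQ
    refine ⟨W.liftQ f hfW, fun x hx => ?_⟩
    have hlq : ∀ j, W.liftQ f hfW (q j) = c j := by
      intro j
      simp only [q, Submodule.mkQ_apply, Submodule.liftQ_apply, hf]
    have hcδ : c i₀ = δ := by
      simp only [c, ← ha₀]
      ring
    obtain ⟨i, hi⟩ := hmem x hx
    rw [hψ i x hi, map_add, map_smul, hlq, hlq, hcδ, hc i x hi, smul_eq_mul]
    ring
end

section
/- Let A = {a₁, …, a_k} ⊆ ℤ^m be a finite set of cardinality k. Let M_A be the matrix with k columns whose rows are all vectors e_{i₁} + e_{i₂} − e_{i₃} − e_{i₄} ∈ ℤ^k such that a_{i₁} + a_{i₂} = a_{i₃} + a_{i₄} and not i₁ = i₂ = i₃ = i₄. Then dim(A) = k − 1 − rank(M_A), where rank denotes the rank of the matrix over ℚ. -/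
open Pointwise

/-- The rank over `ℚ` of the matrix `M_A` whose rows are the vectors
`e_{i₁} + e_{i₂} - e_{i₃} - e_{i₄}` for which `a_{i₁} + a_{i₂} = a_{i₃} + a_{i₄}`
and not `i₁ = i₂ = i₃ = i₄`, computed as the dimension of the row span. -/
noncomputable def relRank {k m : ℕ} (a : Fin k → (Fin m → ℤ)) : ℕ :=
  Module.finrank ℚ (Submodule.span ℚ
    {v : Fin k → ℚ | ∃ i₁ i₂ i₃ i₄ : Fin k,
      ¬(i₁ = i₂ ∧ i₁ = i₃ ∧ i₁ = i₄) ∧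
      a i₁ + a i₂ = a i₃ + a i₄ ∧
      v = Pi.single i₁ 1 + Pi.single i₂ 1 - Pi.single i₃ 1 - Pi.single i₄ 1})

/-- The rational-valued functions on the index set that respect all additive quadruples of `a`. -/
def quadrupleRespecting {k : ℕ} {G : Type*} [AddCommGroup G] (a : Fin k → G) :
    Submodule ℚ (Fin k → ℚ) where
  carrier := {x | ∀ i₁ i₂ i₃ i₄, a i₁ + a i₂ = a i₃ + a i₄ → x i₁ + x i₂ = x i₃ + x i₄}
  add_mem' := by
    intro x y hx hy i₁ i₂ i₃ i₄ h
    have h₁ := hx _ _ _ _ h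
    have h₂ := hy _ _ _ _ h
    simp only [Pi.add_apply]
    linarith
  zero_mem' := by
    intro i₁ i₂ i₃ i₄ _
    simp
  smul_mem' := by
    intro c x hx i₁ i₂ i₃ i₄ h
    simp only [Pi.smul_apply, smul_eq_mul, ← mul_add, hx _ _ _ _ h]

theorem one_mem_quadrupleRespecting {k : ℕ} {G : Type*} [AddCommGroup G] (a : Fin k → G) :
    (1 : Fin k → ℚ) ∈ quadrupleRespecting a :=
  fun _ _ _ _ _ => rfl

theorem finrank_quadrupleRespecting_add_relRank {k m : ℕ} (a : Fin k → (Fin m → ℤ)) :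
    relRank a + Module.finrank ℚ (quadrupleRespecting a) = k := by
  have key := Subspace.finrank_add_finrank_dualAnnihilator_eq (Submodule.span ℚ
    {v : Fin k → ℚ | ∃ i₁ i₂ i₃ i₄ : Fin k,
      ¬(i₁ = i₂ ∧ i₁ = i₃ ∧ i₁ = i₄) ∧
      a i₁ + a i₂ = a i₃ + a i₄ ∧
      v = Pi.single i₁ 1 + Pi.single i₂ 1 - Pi.single i₃ 1 - Pi.single i₄ 1})
  rw [Module.finrank_fin_fun] at key
  let e := (Pi.basisFun ℚ (Fin k)).constr (M' := ℚ) ℚ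
  have he : ∀ (x : Fin k → ℚ) i, e x (Pi.single i 1) = x i := fun x i => by
    rw [← Pi.basisFun_apply ℚ]
    exact (Pi.basisFun ℚ (Fin k)).constr_basis ℚ x i
  have hmap : (quadrupleRespecting a).map (e : (Fin k → ℚ) →ₗ[ℚ] _) =
      Submodule.dualAnnihilator (Submodule.span ℚ
    {v : Fin k → ℚ | ∃ i₁ i₂ i₃ i₄ : Fin k,
      ¬(i₁ = i₂ ∧ i₁ = i₃ ∧ i₁ = i₄) ∧
      a i₁ + a i₂ = a i₃ + a i₄ ∧
      v = Pi.single i₁ 1 + Pi.single i₂ 1 - Pi.single i₃ 1 - Pi.single i₄ 1}) := by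
    ext f
    obtain ⟨x, rfl⟩ := e.surjective f
    rw [← SetLike.mem_coe (p := Submodule.dualAnnihilator _),
      Submodule.coe_dualAnnihilator_span]
    have hx : e x ∈ (quadrupleRespecting a).map (e : (Fin k → ℚ) →ₗ[ℚ] _) ↔
        x ∈ quadrupleRespecting a := by
      rw [Submodule.mem_map]
      constructor
      · rintro ⟨y, hy, hyx⟩
        rwa [← e.injective hyx]
      · exact fun h => ⟨x, h, rfl⟩
    rw [hx]
    constructor
    · rintro h _ ⟨i₁, i₂, i₃, i₄, -, hi, rfl⟩
      have := h _ _ _ _ hi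
      rw [SetLike.mem_coe, LinearMap.mem_ker, map_sub, map_sub, map_add, he, he, he, he]
      linarith
    · intro h i₁ i₂ i₃ i₄ hi
      by_cases hd : i₁ = i₂ ∧ i₁ = i₃ ∧ i₁ = i₄
      · obtain ⟨rfl, rfl, rfl⟩ := hd
        rfl
      · have := h ⟨i₁, i₂, i₃, i₄, hd, hi, rfl⟩
        rw [SetLike.mem_coe, LinearMap.mem_ker, map_sub, map_sub, map_add, he, he, he, he] at this
        linarith
  rw [← hmap, LinearEquiv.finrank_map_eq] at key
  exact key

/-- The coordinates of a full-dimensional witness, together with the constant function, are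
linearly independent functions respecting the additive quadruples. -/
theorem HasFullDimWitness.add_one_le_finrank {k d : ℕ} {G : Type*} [AddCommGroup G]
    [DecidableEq G] (hk : 0 < k) (a : Fin k → G)
    (h : HasFullDimWitness (Finset.univ.image a) d) :
    d + 1 ≤ Module.finrank ℚ (quadrupleRespecting a) := by
  obtain ⟨B, ⟨φ, hbij, hφ⟩, hB⟩ := h
  have hmem : ∀ i, a i ∈ Finset.univ.image a := fun i =>
    Finset.mem_image_of_mem a (Finset.mem_univ i)
  let f : Fin d → quadrupleRespecting a := fun j => ⟨fun i => (φ (a i) j : ℚ), by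
    intro i₁ i₂ i₃ i₄ hi
    have := congrFun ((hφ _ (hmem i₁) _ (hmem i₂) _ (hmem i₃) _ (hmem i₄)).1 hi) j
    simp only [Pi.add_apply] at this
    beta_reduce
    exact_mod_cast this⟩
  let v : Fin (d + 1) → quadrupleRespecting a :=
    Fin.cons ⟨1, one_mem_quadrupleRespecting a⟩ f
  have hv : LinearIndependent ℤ v := by
    rw [Fintype.linearIndependent_iff]
    intro g hg
    have heval : ∀ i, g 0 + ∑ j : Fin d, g j.succ * φ (a i) j = 0 := by
      intro i
      have := congrFun (congrArg Subtype.val hg) i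
      simp [v, f, Fin.sum_univ_succ, Finset.sum_apply] at this
      exact_mod_cast this
    have hc : (fun j : Fin d => g j.succ) = 0 := by
      apply hB _ (-g 0)
      intro x hx
      obtain ⟨y, hy, rfl⟩ := hbij.surjOn hx
      obtain ⟨i, -, rfl⟩ := Finset.mem_image.1 hy
      linarith [heval i]
    have hs : ∀ j : Fin d, g j.succ = 0 := congrFun hc
    refine Fin.cases ?_ hs
    simpa [hs] using heval ⟨0, hk⟩
  have hvQ : LinearIndependent ℚ v := (LinearIndependent.iff_fractionRing ℤ ℚ).1 hv
  simpa using hvQ.fintype_card_le_finrank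

/-- A nonzero vector extends to a basis. -/
theorem exists_basis_mod_span_singleton {K V : Type*} [Field K] [AddCommGroup V] [Module K V]
    [FiniteDimensional K V] {d : ℕ} {o : V} (ho : o ≠ 0) (hd : Module.finrank K V = d + 1) :
    ∃ u : Fin d → V, (∀ (c : Fin d → K) (t : K), ∑ j, c j • u j = t • o → c = 0) ∧
      ∀ x : V, ∃ (s : K) (c : Fin d → K), x = s • o + ∑ j, c j • u j := by
  obtain ⟨U, hU⟩ := Submodule.exists_isCompl (K ∙ o)
  have hUd : Module.finrank K U = d := by
    have := Submodule.finrank_add_eq_of_isCompl hU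
    rw [finrank_span_singleton ho] at this
    omega
  let u := Module.finBasisOfFinrankEq K U hUd
  refine ⟨fun j => u j, fun c t h => ?_, fun x => ?_⟩
  · have h0 := Submodule.disjoint_def.1 hU.disjoint (∑ j, c j • (u j : V))
      (h ▸ Submodule.smul_mem _ _ (Submodule.mem_span_singleton_self o))
      (Submodule.sum_mem _ fun j _ => Submodule.smul_mem _ _ (u j).2)
    exact funext (Fintype.linearIndependent_iff.1 u.linearIndependent c
      (Subtype.ext (by simpa using h0)))
  · obtain ⟨y, hy, z, hz, rfl⟩ := Submodule.mem_sup.1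
      (hU.sup_eq_top ▸ Submodule.mem_top : x ∈ (K ∙ o) ⊔ U)
    obtain ⟨s, rfl⟩ := Submodule.mem_span_singleton.1 hy
    refine ⟨s, u.repr ⟨z, hz⟩, congrArg _ ?_⟩
    have h := congrArg U.subtype (u.sum_repr ⟨z, hz⟩)
    simp only [map_sum, map_smul, Submodule.subtype_apply] at h
    exact h.symm

/-- An integral basis of the functions respecting the additive quadruples of `a`, modulo
constants. -/
theorem exists_integral_basis_mod_constants {k d : ℕ} {G : Type*} [AddCommGroup G] (hk : 0 < k)
    (a : Fin k → G) (hd : Module.finrank ℚ (quadrupleRespecting a) = d + 1) :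
    ∃ b : Fin k → Fin d → ℤ,
      (∀ j, (fun i => (b i j : ℚ)) ∈ quadrupleRespecting a) ∧
      (∀ (c : Fin d → ℤ) (t : ℤ), (∀ i, ∑ j, c j * b i j = t) → c = 0) ∧
      ∀ x ∈ quadrupleRespecting a, ∃ (s : ℚ) (c : Fin d → ℚ),
        ∀ i, x i = s + ∑ j, c j * b i j := by
  let o : quadrupleRespecting a := ⟨1, one_mem_quadrupleRespecting a⟩
  have ho : o ≠ 0 := fun h => by
    simpa [o] using congrFun (congrArg Subtype.val h) ⟨0, hk⟩
  obtain ⟨u, hindep, hspan⟩ := exists_basis_mod_span_singleton ho hd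
  obtain ⟨⟨N, hN⟩, hint⟩ := IsLocalization.exist_integer_multiples_of_finite
    (nonZeroDivisors ℤ) (fun p : Fin k × Fin d => (u p.2 : Fin k → ℚ) p.1)
  have hN0 : (N : ℚ) ≠ 0 := by exact_mod_cast nonZeroDivisors.ne_zero hN
  choose b' hb' using hint
  have hb : ∀ i j, (b' (i, j) : ℚ) = N * (u j : Fin k → ℚ) i := by
    intro i j
    simpa using hb' (i, j)
  refine ⟨fun i j => b' (i, j), fun j => ?_, fun c t h => ?_, fun x hx => ?_⟩
  · have := (quadrupleRespecting a).smul_mem (N : ℚ) (u j).2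
    convert this using 1
    ext i
    simp [hb]
  · have h1 := hindep (fun j => (c j * N : ℚ)) t (by
      ext i
      have : (∑ j, (c j : ℚ) * b' (i, j)) = t := by exact_mod_cast h i
      simp [o, Finset.sum_apply, ← this, hb, mul_assoc])
    ext j
    simpa [hN0] using congrFun h1 j
  · obtain ⟨s, c, hsc⟩ := hspan ⟨x, hx⟩
    refine ⟨s, fun j => c j / N, fun i => ?_⟩
    have h1 := congrFun (congrArg Subtype.val hsc) i
    simp only [o, Submodule.coe_add, Submodule.coe_smul, Submodule.coe_sum, Pi.add_apply,
      Pi.smul_apply, Finset.sum_apply, smul_eq_mul, Pi.one_apply, mul_one] at h1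
    rw [h1]
    congr 1
    refine Finset.sum_congr rfl fun j _ => ?_
    rw [hb]
    field_simp

theorem hasFullDimWitness_of_finrank {k m d : ℕ} (hk : 0 < k) (a : Fin k → (Fin m → ℤ))
    (ha : Function.Injective a) (hd : Module.finrank ℚ (quadrupleRespecting a) = d + 1) :
    HasFullDimWitness (Finset.univ.image a) d := by
  obtain ⟨b, hmem, hindep, hspan⟩ := exists_integral_basis_mod_constants hk a hd
  have hiff : ∀ i₁ i₂ i₃ i₄, a i₁ + a i₂ = a i₃ + a i₄ ↔ b i₁ + b i₂ = b i₃ + b i₄ := by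
    intro i₁ i₂ i₃ i₄
    constructor
    · intro h
      ext j
      have := hmem j _ _ _ _ h
      beta_reduce at this
      simp only [Pi.add_apply]
      exact_mod_cast this
    · intro h
      ext l
      obtain ⟨s, c, hc⟩ := hspan (fun i => (a i l : ℚ)) (by
        intro i₁ i₂ i₃ i₄ h
        have := congrFun h l
        simp only [Pi.add_apply] at this
        beta_reduce
        exact_mod_cast this)
      have hsum : ∑ j, c j * b i₁ j + ∑ j, c j * b i₂ j =
          ∑ j, c j * b i₃ j + ∑ j, c j * b i₄ j := by
        simp only [← Finset.sum_add_distrib, ← mul_add]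
        refine Finset.sum_congr rfl fun j _ => ?_
        have := congrFun h j
        simp only [Pi.add_apply] at this
        rw [show (b i₁ j + b i₂ j : ℚ) = b i₃ j + b i₄ j by exact_mod_cast this]
      have : (a i₁ l + a i₂ l : ℚ) = a i₃ l + a i₄ l := by
        rw [hc i₁, hc i₂, hc i₃, hc i₄]
        linarith
      simp only [Pi.add_apply]
      exact_mod_cast this
  have hb : Function.Injective b := fun i i' h =>
    ha (add_right_cancel ((hiff i i i' i).2 (by rw [h])))
  have hφ : ∀ i, Function.extend a b 0 (a i) = b i := fun i => ha.extend_apply b 0 i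
  refine ⟨Finset.univ.image b, ⟨Function.extend a b 0, ⟨?_, ?_, ?_⟩, ?_⟩, ?_⟩
  · intro x hx
    obtain ⟨i, -, rfl⟩ := Finset.mem_image.1 hx
    rw [hφ]
    exact Finset.mem_image_of_mem b (Finset.mem_univ i)
  · intro x hx y hy hxy
    obtain ⟨i, -, rfl⟩ := Finset.mem_image.1 hx
    obtain ⟨i', -, rfl⟩ := Finset.mem_image.1 hy
    rw [hφ, hφ] at hxy
    rw [hb hxy]
  · intro y hy
    obtain ⟨i, -, rfl⟩ := Finset.mem_image.1 hy
    exact ⟨a i, Finset.mem_image_of_mem a (Finset.mem_univ i), hφ i⟩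
  · simp only [Finset.forall_mem_image, hφ]
    exact fun i₁ _ i₂ _ i₃ _ i₄ _ => hiff i₁ i₂ i₃ i₄
  · exact fun c t h => hindep c t fun i => h _ (Finset.mem_image_of_mem b (Finset.mem_univ i))

theorem hasAddDim_empty {G : Type*} [AddCommGroup G] : HasAddDim (∅ : Finset G) 0 := by
  refine ⟨⟨∅, ⟨0, by simp, by simp⟩, fun c t _ => Subsingleton.elim _ _⟩, ?_⟩
  rintro d ⟨B, ⟨φ, hbij, -⟩, hB⟩
  have hBe : B = ∅ := by
    have := hbij.image_eq
    simpa using this.symm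
  subst hBe
  by_contra! hd
  simpa using congrFun (hB 1 0 (by simp)) ⟨0, hd⟩

/-- Theorem 2.1 (Konyagin–Lev): `dim(A) = |A| - 1 - rank(M_A)`. -/
theorem konyagin_lev (k m : ℕ) (a : Fin k → (Fin m → ℤ)) (ha : Function.Injective a)
    (A : Finset (Fin m → ℤ)) (hA : A = Finset.univ.image a) :
    HasAddDim A (k - 1 - relRank a) := by
  subst hA
  obtain rfl | hk := Nat.eq_zero_or_pos k
  · simpa using hasAddDim_empty (G := Fin m → ℤ)
  have hrank := finrank_quadrupleRespecting_add_relRank a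
  have hpos : 0 < Module.finrank ℚ (quadrupleRespecting a) := by
    have : Nontrivial (quadrupleRespecting a) :=
      ⟨⟨1, one_mem_quadrupleRespecting a⟩, 0, fun h => by
        simpa using congrFun (congrArg Subtype.val h) ⟨0, hk⟩⟩
    exact Module.finrank_pos
  refine ⟨hasFullDimWitness_of_finrank hk a ha (by omega), fun d h => ?_⟩
  have := h.add_one_le_finrank hk a
  omega
end

section
/- Let A ⊆ ℤ be a set of cardinality k and additive dimension 1 which is the union of s ≤ k − 1 disjoint segments P₁, …, P_s with max P_i < min P_{i+1} for 1 ≤ i < s. Assume that every finite set B ⊆ ℤ of additive dimension 1 whose minimum number of disjoint segments in a decomposition is s − 1, with s − 1 ≤ |B| − 1, satisfies vol(B) ≤ 2^{s−2}(|B| − (s−1)) + 1. If vol(A) > 2^{s−1}(k − s) + 1, then for all 1 ≤ i ≤ s and 1 ≤ j < s we have max(P_i + P_j) < min(P_i + P_{j+1}). -/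
open Pointwise

/-- `ψ` preserves the additive quadruples of `A`. -/
def PreservesSums (A : Finset ℤ) (ψ : ℤ → ℤ) : Prop :=
  ∀ x ∈ A, ∀ y ∈ A, ∀ z ∈ A, ∀ t ∈ A, x + y = z + t → ψ x + ψ y = ψ z + ψ t

/-- `ψ` preserves and reflects the additive quadruples of `A`. -/
def IsF2Embedding (A : Finset ℤ) (ψ : ℤ → ℤ) : Prop :=
  ∀ x ∈ A, ∀ y ∈ A, ∀ z ∈ A, ∀ t ∈ A, (x + y = z + t ↔ ψ x + ψ y = ψ z + ψ t)

/-- Every map preserving the additive quadruples of `A` is determined on `A` by its values at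
two distinct points of `A`. -/
def IsPinned (A : Finset ℤ) : Prop :=
  ∃ x₀ ∈ A, ∃ y₀ ∈ A, x₀ ≠ y₀ ∧
    ∀ ψ : ℤ → ℤ, PreservesSums A ψ → ψ x₀ = 0 → ψ y₀ = 0 → ∀ z ∈ A, ψ z = 0

/-- The elements of `A` whose successor is not in `A`. -/
def rightEnds (A : Finset ℤ) : Finset ℤ := A.filter fun x => x + 1 ∉ A

lemma mem_rightEnds {A : Finset ℤ} {x : ℤ} : x ∈ rightEnds A ↔ x ∈ A ∧ x + 1 ∉ A := by
  simp [rightEnds]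

lemma PreservesSums.mono {A A' : Finset ℤ} {ψ : ℤ → ℤ} (h : A ⊆ A') (hψ : PreservesSums A' ψ) :
    PreservesSums A ψ :=
  fun x hx y hy z hz t ht => hψ x (h hx) y (h hy) z (h hz) t (h ht)

lemma IsF2Embedding.mono {A A' : Finset ℤ} {ψ : ℤ → ℤ} (h : A ⊆ A') (hψ : IsF2Embedding A' ψ) :
    IsF2Embedding A ψ :=
  fun x hx y hy z hz t ht => hψ x (h hx) y (h hy) z (h hz) t (h ht)

lemma IsF2Embedding.preservesSums {A : Finset ℤ} {ψ : ℤ → ℤ} (hψ : IsF2Embedding A ψ) :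
    PreservesSums A ψ :=
  fun x hx y hy z hz t ht => (hψ x hx y hy z hz t ht).1

/-! ### Additive dimension one -/

/-- On a pinned set, maps preserving additive quadruples are affine. -/
lemma IsPinned.affine {A : Finset ℤ} (hA : IsPinned A) {ψ : ℤ → ℤ} (hψ : PreservesSums A ψ)
    {x y z : ℤ} (hx : x ∈ A) (hy : y ∈ A) (hz : z ∈ A) :
    (ψ z - ψ x) * (y - x) = (ψ y - ψ x) * (z - x) := by
  obtain ⟨x₀, hx₀, y₀, hy₀, hne, hpin⟩ := hA
  have key : ∀ w ∈ A, (ψ w - ψ x₀) * (y₀ - x₀) - (ψ y₀ - ψ x₀) * (w - x₀) = 0 := by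
    refine hpin (fun w => (ψ w - ψ x₀) * (y₀ - x₀) - (ψ y₀ - ψ x₀) * (w - x₀)) ?_ (by ring)
      (by ring)
    intro a ha b hb c hc d hd h
    have h' := hψ a ha b hb c hc d hd h
    linear_combination (y₀ - x₀) * h' - (ψ y₀ - ψ x₀) * h
  have h0 : y₀ - x₀ ≠ 0 := sub_ne_zero.2 hne.symm
  apply mul_left_cancel₀ h0
  linear_combination (y - x) * (key z hz) - (z - x) * (key y hy) + (z - y) * (key x hx)

lemma HasAddDim.isPinned {A : Finset ℤ} (hA : HasAddDim A 1) : IsPinned A := by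
  obtain ⟨⟨B, ⟨φ, hφ, -⟩, hB⟩, hmax⟩ := hA
  have hnt : (A : Set ℤ).Nontrivial := by
    by_contra hsub
    rw [Set.not_nontrivial_iff] at hsub
    have hBs : (B : Set (Fin 1 → ℤ)).Subsingleton := by
      rw [← hφ.image_eq]
      exact hsub.image φ
    have hc : (fun _ => 1 : Fin 1 → ℤ) = 0 := by
      rcases B.eq_empty_or_nonempty with hBe | ⟨b, hb⟩
      · exact hB _ 0 (by simp [hBe])
      · refine hB _ (b 0) fun x hx => ?_
        rw [hBs hx hb]
        simp
    exact one_ne_zero (congrFun hc 0)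
  obtain ⟨x₀, hx₀, y₀, hy₀, hne⟩ := hnt
  refine ⟨x₀, hx₀, y₀, hy₀, hne, fun ψ hψ h1 h2 z hz => ?_⟩
  by_contra hψz
  have : HasFullDimWitness A 2 := by
    refine ⟨A.image fun x => ![x, ψ x], ⟨fun x => ![x, ψ x], ?_, ?_⟩, ?_⟩
    · rw [Finset.coe_image]
      refine Set.InjOn.bijOn_image fun x _ y _ h => ?_
      simpa using congrFun h 0
    · intro x hx y hy z hz t ht
      constructor
      · intro h
        ext i
        fin_cases i
        · simpa using h
        · simpa using hψ x hx y hy z hz t ht h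
      · intro h
        simpa using congrFun h 0
    · intro c t h
      simp only [Finset.mem_image, forall_exists_index, and_imp, forall_apply_eq_imp_iff₂,
        Fin.sum_univ_two, Matrix.cons_val_zero, Matrix.cons_val_one] at h
      have e1 := h x₀ hx₀
      have e2 := h y₀ hy₀
      have e3 := h z hz
      rw [h1] at e1
      rw [h2] at e2
      have c0 : c 0 = 0 := by
        have : c 0 * (x₀ - y₀) = 0 := by linear_combination e1 - e2
        exact (mul_eq_zero.1 this).resolve_right (sub_ne_zero.2 hne)
      have c1 : c 1 = 0 := by
        rw [c0] at e1 e3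
        have : c 1 * ψ z = 0 := by linear_combination e3 - e1
        exact (mul_eq_zero.1 this).resolve_right hψz
      ext i
      fin_cases i
      · exact c0
      · exact c1
  have := hmax 2 this
  omega

lemma IsPinned.hasAddDim {A : Finset ℤ} (hA : IsPinned A) : HasAddDim A 1 := by
  have hA' := hA
  obtain ⟨x₀, hx₀, y₀, hy₀, hne, -⟩ := hA'
  refine ⟨⟨A.image fun x _ => x, ⟨fun x _ => x, ?_, ?_⟩, ?_⟩, ?_⟩
  · rw [Finset.coe_image]
    exact Set.InjOn.bijOn_image fun x _ y _ h => congrFun h 0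
  · intro x _ y _ z _ t _
    exact ⟨fun h => funext fun _ => h, fun h => congrFun h 0⟩
  · intro c t h
    have e1 := h _ (Finset.mem_image_of_mem _ hx₀)
    have e2 := h _ (Finset.mem_image_of_mem _ hy₀)
    simp only [Finset.univ_unique, Finset.sum_singleton] at e1 e2
    have : c default * (x₀ - y₀) = 0 := by linear_combination e1 - e2
    have := (mul_eq_zero.1 this).resolve_right (sub_ne_zero.2 hne)
    ext i
    rw [Subsingleton.elim i default]
    exact this
  · rintro d ⟨B, ⟨φ, hφ, hsum⟩, hB⟩
    by_contra! hd
    have hhom : ∀ i, PreservesSums A fun x => φ x i := fun i x hx y hy z hz t ht h =>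
      congrFun ((hsum x hx y hy z hz t ht).1 h) i
    have haff : ∀ i, ∀ z ∈ A, (φ z i - φ x₀ i) * (y₀ - x₀) = (φ y₀ i - φ x₀ i) * (z - x₀) :=
      fun i z hz => hA.affine (hhom i) hx₀ hy₀ hz
    have h0 : y₀ - x₀ ≠ 0 := sub_ne_zero.2 hne.symm
    have hsurj : ∀ b ∈ B, ∃ z ∈ A, φ z = b := fun b hb => hφ.surjOn hb
    let i₀ : Fin d := ⟨0, by omega⟩
    let i₁ : Fin d := ⟨1, by omega⟩
    have hi : i₀ ≠ i₁ := by simp [i₀, i₁]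
    have hD : φ y₀ i₀ - φ x₀ i₀ = 0 := by
      have hc := hB (fun i => if i = i₀ then φ y₀ i₁ - φ x₀ i₁ else
          if i = i₁ then -(φ y₀ i₀ - φ x₀ i₀) else 0)
        ((φ y₀ i₁ - φ x₀ i₁) * φ x₀ i₀ - (φ y₀ i₀ - φ x₀ i₀) * φ x₀ i₁) ?_
      · have := congrFun hc i₁
        simp only [hi.symm, if_false, if_true, Pi.zero_apply] at this
        omega
      · intro b hb
        obtain ⟨z, hz, rfl⟩ := hsurj b hb
        rw [Finset.sum_eq_add i₀ i₁ hi (fun c _ hc => by simp [hc.1, hc.2]) (by simp) (by simp)]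
        simp only [hi.symm, if_false, if_true]
        apply mul_left_cancel₀ h0
        linear_combination (φ y₀ i₁ - φ x₀ i₁) * haff i₀ z hz -
          (φ y₀ i₀ - φ x₀ i₀) * haff i₁ z hz
    have hc := hB (Pi.single i₀ 1) (φ x₀ i₀) ?_
    · simpa using congrFun hc i₀
    · intro b hb
      obtain ⟨z, hz, rfl⟩ := hsurj b hb
      have h1 := haff i₀ z hz
      rw [hD, zero_mul] at h1
      have h2 := (mul_eq_zero.1 h1).resolve_right h0
      rw [Finset.sum_eq_single i₀ (fun c _ hc => by simp [hc]) (by simp)]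
      simp only [Pi.single_eq_same, one_mul]
      omega

lemma IsPinned.extend {A A' : Finset ℤ} (hA : IsPinned A) (hsub : A ⊆ A')
    (h : ∀ ψ : ℤ → ℤ, PreservesSums A' ψ → (∀ z ∈ A, ψ z = 0) → ∀ z ∈ A', ψ z = 0) :
    IsPinned A' := by
  obtain ⟨x₀, hx₀, y₀, hy₀, hne, hpin⟩ := hA
  exact ⟨x₀, hsub hx₀, y₀, hsub hy₀, hne, fun ψ hψ h1 h2 =>
    h ψ hψ (hpin ψ (hψ.mono hsub) h1 h2)⟩

lemma IsPinned.insert_reflection {A : Finset ℤ} (hA : IsPinned A) {m M : ℤ} (hm : m ∈ A)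
    (hM : M ∈ A) : IsPinned (insert (2 * M - m) A) := by
  refine hA.extend (Finset.subset_insert _ _) fun ψ hψ h z hz => ?_
  rcases Finset.mem_insert.1 hz with rfl | hz
  · have := hψ (2 * M - m) (by simp) m (by simp [hm]) M (by simp [hM]) M (by simp [hM]) (by ring)
    rw [h m hm, h M hM] at this
    omega
  · exact h z hz

lemma IsPinned.union_Ioo {A : Finset ℤ} (hA : IsPinned A) {p q : ℤ} (hp : p ∈ A) (hq : q ∈ A)
    (hpq : p < q) : IsPinned (A ∪ Finset.Ioo p q) := by
  refine hA.extend Finset.subset_union_left fun ψ hψ h => ?_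
  have hmem : ∀ x, p ≤ x → x ≤ q → x ∈ A ∪ Finset.Ioo p q := by
    intro x h1 h2
    rw [Finset.mem_union, Finset.mem_Ioo]
    rcases h1.eq_or_lt with rfl | h1
    · exact Or.inl hp
    rcases h2.eq_or_lt with rfl | h2
    · exact Or.inl hq
    exact Or.inr ⟨h1, h2⟩
  have hlin : ∀ n : ℕ, p + n ≤ q → ψ (p + n) = n * ψ (p + 1) := by
    intro n
    induction n with
    | zero => simpa using fun _ => h p hp
    | succ n ih =>
      intro hn
      push_cast at hn ⊢
      have := hψ (p + (n + 1)) (hmem _ (by omega) hn) p (hmem _ le_rfl hpq.le)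
        (p + n) (hmem _ (by omega) (by omega)) (p + 1) (hmem _ (by omega) (by omega)) (by ring)
      rw [ih (by omega), h p hp] at this
      linear_combination this
  have hlin' : ∀ x, p ≤ x → x ≤ q → ψ x = (x - p) * ψ (p + 1) := by
    intro x h1 h2
    have hx : p + ((x - p).toNat : ℤ) = x := by omega
    have := hlin (x - p).toNat (by omega)
    rw [hx] at this
    rw [this]
    congr 1
    omega
  have hstep : ψ (p + 1) = 0 := by
    have := hlin' q hpq.le le_rfl
    rw [h q hq] at this
    exact (mul_eq_zero.1 this.symm).resolve_left (by omega)
  intro z hz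
  rcases Finset.mem_union.1 hz with hz | hz
  · exact h z hz
  · rw [Finset.mem_Ioo] at hz
    rw [hlin' z hz.1.le hz.2.le, hstep, mul_zero]

/-! ### Volume of sets of additive dimension one -/

lemma hullCard_of_forall_mem_uIcc {B : Finset (Fin 1 → ℤ)} {p q : Fin 1 → ℤ} (hp : p ∈ B)
    (hq : q ∈ B) (h : ∀ x ∈ B, x 0 ∈ Set.uIcc (p 0) (q 0)) :
    (hullCard B : ℤ) = |q 0 - p 0| + 1 := by
  have hset : {x : Fin 1 → ℤ | (fun i => (x i : ℝ)) ∈ convexHull ℝ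
      ((fun (v : Fin 1 → ℤ) (i : Fin 1) => (v i : ℝ)) '' (B : Set (Fin 1 → ℤ)))} =
      (fun n _ => n) '' (Finset.uIcc (p 0) (q 0) : Set ℤ) := by
    ext x
    simp only [Set.mem_ofPred_eq, Set.mem_image, Finset.coe_uIcc]
    constructor
    · intro hx
      refine ⟨x 0, ?_, funext fun i => by rw [Subsingleton.elim i 0]⟩
      have hconv : Convex ℝ ((LinearMap.proj 0 : (Fin 1 → ℝ) →ₗ[ℝ] ℝ) ⁻¹'
          Set.uIcc (p 0 : ℝ) (q 0 : ℝ)) := (convex_uIcc _ _).linear_preimage _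
      have := convexHull_min (s := (fun (v : Fin 1 → ℤ) (i : Fin 1) => (v i : ℝ)) ''
        (B : Set (Fin 1 → ℤ))) (fun y hy => ?_) hconv hx
      · simpa only [Set.mem_preimage, LinearMap.proj_apply, Set.mem_uIcc, Int.cast_le] using this
      · obtain ⟨b, hb, rfl⟩ := hy
        simpa only [Set.mem_preimage, LinearMap.proj_apply, Set.mem_uIcc, Int.cast_le] using h b hb
    · rintro ⟨n, hn, rfl⟩
      refine segment_subset_convexHull (𝕜 := ℝ) (Set.mem_image_of_mem _ hp)
        (Set.mem_image_of_mem _ hq) ?_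
      have hn' : (n : ℝ) ∈ segment ℝ (p 0 : ℝ) (q 0 : ℝ) := by
        rw [segment_eq_uIcc]
        simpa only [Set.mem_uIcc, Int.cast_le] using hn
      obtain ⟨a, b, ha, hb, hab, hn'⟩ := hn'
      refine ⟨a, b, ha, hb, hab, funext fun i => ?_⟩
      rw [Subsingleton.elim i 0]
      exact hn'
  have hinj : Function.Injective (fun (n : ℤ) (_ : Fin 1) => n) := fun a b hab => congrFun hab 0
  rw [hullCard, hset, Set.ncard_image_of_injective _ hinj, Set.ncard_coe_finset, Int.card_uIcc]
  simp

lemma IsPinned.mem_uIcc {A : Finset ℤ} (hA : IsPinned A) {ψ : ℤ → ℤ} (hψ : PreservesSums A ψ)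
    {m M : ℤ} (hm : m ∈ A) (hM : M ∈ A) (hmM : ∀ x ∈ A, m ≤ x ∧ x ≤ M) {x : ℤ} (hx : x ∈ A) :
    ψ x ∈ Set.uIcc (ψ m) (ψ M) := by
  have haff := hA.affine hψ hm hM hx
  have hlt : 0 < M - m := by
    obtain ⟨x₀, hx₀, y₀, hy₀, hne, -⟩ := hA
    have := hmM _ hx₀
    have := hmM _ hy₀
    omega
  obtain ⟨h1, h2⟩ := hmM x hx
  rw [Set.mem_uIcc]
  rcases le_total (ψ m) (ψ M) with hle | hle
  · left
    constructor
    · by_contra! hc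
      nlinarith
    · by_contra! hc
      nlinarith
  · right
    constructor
    · by_contra! hc
      nlinarith
    · by_contra! hc
      nlinarith

lemma HasVolume.isLeast {A : Finset ℤ} {v : ℕ} (hA : HasAddDim A 1) (hv : HasVolume A v) :
    IsLeast {n : ℕ | ∃ B : Finset (Fin 1 → ℤ), F2Isomorphic A B ∧ hullCard B = n} v := by
  obtain ⟨d, hd, hv⟩ := hv
  obtain rfl : d = 1 := le_antisymm (hA.2 d hd.1) (hd.2 1 hA.1)
  exact hv

lemma HasAddDim.exists_hasVolume {A : Finset ℤ} (hA : HasAddDim A 1) : ∃ v, HasVolume A v := by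
  classical
  obtain ⟨B, hB, -⟩ := hA.1
  have hex : ∃ n : ℕ, ∃ B : Finset (Fin 1 → ℤ), F2Isomorphic A B ∧ hullCard B = n := ⟨_, B, hB, rfl⟩
  exact ⟨Nat.find hex, 1, hA, Nat.find_spec hex, fun n hn => Nat.find_min' hex hn⟩

lemma HasVolume.sub_one_le {A : Finset ℤ} {v : ℕ} (hA : IsPinned A) (hv : HasVolume A v)
    {m M : ℤ} (hm : m ∈ A) (hM : M ∈ A) (hmM : ∀ x ∈ A, m ≤ x ∧ x ≤ M) {ψ : ℤ → ℤ}
    (hψ : IsF2Embedding A ψ) : (v : ℤ) - 1 ≤ |ψ M - ψ m| := by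
  have hle : v ≤ hullCard (A.image fun x (_ : Fin 1) => ψ x) := by
    refine (hv.isLeast hA.hasAddDim).2 ⟨_, ⟨fun x _ => ψ x, ?_, ?_⟩, rfl⟩
    · rw [Finset.coe_image]
      refine Set.InjOn.bijOn_image fun x hx y hy h => ?_
      have h' : ψ x = ψ y := congrFun h 0
      have := (hψ x hx x hx y hy x hx).2 (by rw [h'])
      omega
    · intro x hx y hy z hz t ht
      rw [hψ x hx y hy z hz t ht]
      exact ⟨fun h => funext fun _ => h, fun h => congrFun h 0⟩
  have := hullCard_of_forall_mem_uIcc (B := A.image fun x (_ : Fin 1) => ψ x)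
    (Finset.mem_image_of_mem _ hm) (Finset.mem_image_of_mem _ hM) (by
      intro y hy
      obtain ⟨x, hx, rfl⟩ := Finset.mem_image.1 hy
      exact hA.mem_uIcc hψ.preservesSums hm hM hmM hx)
  omega

lemma HasVolume.exists_embedding {A : Finset ℤ} {v : ℕ} (hA : IsPinned A) (hv : HasVolume A v)
    {m M : ℤ} (hm : m ∈ A) (hM : M ∈ A) (hmM : ∀ x ∈ A, m ≤ x ∧ x ≤ M) :
    ∃ ψ, IsF2Embedding A ψ ∧ (v : ℤ) - 1 = |ψ M - ψ m| := by
  obtain ⟨B, ⟨φ, hφ, hsum⟩, hB⟩ := (hv.isLeast hA.hasAddDim).1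
  have hψ : IsF2Embedding A fun x => φ x 0 := by
    intro x hx y hy z hz t ht
    rw [hsum x hx y hy z hz t ht]
    exact ⟨fun h => congrFun h 0, fun h => funext fun i => by rwa [Subsingleton.elim i 0]⟩
  refine ⟨_, hψ, ?_⟩
  have := hullCard_of_forall_mem_uIcc (hφ.mapsTo hm) (hφ.mapsTo hM) (by
      intro y hy
      obtain ⟨x, hx, rfl⟩ := hφ.surjOn hy
      exact hA.mem_uIcc hψ.preservesSums hm hM hmM hx)
  rw [← hB]
  omega

/-- For nested sets of additive dimension one, the smaller set has the larger ratio of diameter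
to volume. -/
lemma HasVolume.mul_le_mul_of_subset {A A' : Finset ℤ} {v v' : ℕ} (hA : IsPinned A)
    (hA' : IsPinned A') (hsub : A ⊆ A') (hv : HasVolume A v) (hv' : HasVolume A' v')
    {m M m' M' : ℤ} (hm : m ∈ A) (hM : M ∈ A) (hmM : ∀ x ∈ A, m ≤ x ∧ x ≤ M)
    (hm' : m' ∈ A') (hM' : M' ∈ A') (hmM' : ∀ x ∈ A', m' ≤ x ∧ x ≤ M') :
    ((v : ℤ) - 1) * (M' - m') ≤ ((v' : ℤ) - 1) * (M - m) := by
  obtain ⟨ψ, hψ, hv'ψ⟩ := hv'.exists_embedding hA' hm' hM' hmM'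
  have hvψ := hv.sub_one_le hA hm hM hmM (hψ.mono hsub)
  have h1 := hA'.affine hψ.preservesSums hm' hM' (hsub hm)
  have h2 := hA'.affine hψ.preservesSums hm' hM' (hsub hM)
  have h3 : (ψ M - ψ m) * (M' - m') = (ψ M' - ψ m') * (M - m) := by linear_combination h2 - h1
  have p1 : 0 ≤ M' - m' := sub_nonneg.2 (hmM' M' hM').1
  have p2 : 0 ≤ M - m := sub_nonneg.2 (hmM M hM).1
  calc ((v : ℤ) - 1) * (M' - m') ≤ |ψ M - ψ m| * (M' - m') := mul_le_mul_of_nonneg_right hvψ p1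
    _ = |(ψ M - ψ m) * (M' - m')| := by rw [abs_mul, abs_of_nonneg p1]
    _ = ((v' : ℤ) - 1) * (M - m) := by rw [h3, abs_mul, abs_of_nonneg p2, hv'ψ]

/-! ### Counting segments -/

lemma card_rightEnds_le {A : Finset ℤ} {n : ℕ} {P : Fin n → Finset ℤ}
    (hseg : ∀ i, ∃ a b : ℤ, a ≤ b ∧ P i = Finset.Icc a b) (hA : A = Finset.univ.biUnion P) :
    (rightEnds A).card ≤ n := by
  choose a b _ hP using hseg
  have hsub : rightEnds A ⊆ Finset.univ.image b := by
    intro x hx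
    rw [mem_rightEnds, hA] at hx
    simp only [Finset.mem_biUnion, Finset.mem_univ, true_and, not_exists, hP, Finset.mem_Icc] at hx
    obtain ⟨⟨i, hi⟩, hx⟩ := hx
    have := hx i
    exact Finset.mem_image.2 ⟨i, Finset.mem_univ i, by omega⟩
  calc _ ≤ _ := Finset.card_le_card hsub
    _ ≤ _ := Finset.card_image_le
    _ = n := by simp

lemma exists_rightEnd {A : Finset ℤ} {x y : ℤ} (hx : x ∈ A) (hxy : x ≤ y) (hy : y ∉ A) :
    ∃ r ∈ rightEnds A, x ≤ r ∧ r < y := by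
  obtain ⟨r, hr, hmax⟩ := (A.filter fun z => x ≤ z ∧ z < y).exists_max_image id
    ⟨x, by simp only [Finset.mem_filter]; exact ⟨hx, le_rfl, lt_of_le_of_ne hxy (by grind)⟩⟩
  simp only [Finset.mem_filter, id] at hr hmax
  refine ⟨r, mem_rightEnds.2 ⟨hr.1, fun h => ?_⟩, hr.2⟩
  have hne : r + 1 ≠ y := fun h' => hy (h' ▸ h)
  have := hmax (r + 1) ⟨h, by omega, by omega⟩
  omega

lemma exists_rightEnd_ge {A : Finset ℤ} {x : ℤ} (hx : x ∈ A) : ∃ r ∈ rightEnds A, x ≤ r := by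
  obtain ⟨r, hr, hmax⟩ := A.exists_max_image id ⟨x, hx⟩
  refine ⟨r, mem_rightEnds.2 ⟨hr, fun h => ?_⟩, hmax x hx⟩
  have := hmax _ h
  simp at this

/-- A set containing two consecutive integers is the union of as many segments as it has right
ends. -/
lemma unionOfSegments_card_rightEnds {A : Finset ℤ} (hA : (rightEnds A).card < A.card) :
    UnionOfSegments A (rightEnds A).card := by
  classical
  set R := rightEnds A with hR
  let c : ℤ → ℕ := fun x => (R.filter (· < x)).card
  have hmono : Monotone c := fun x y hxy => Finset.card_le_card fun r hr => by
    simp only [Finset.mem_filter] at hr ⊢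
    exact ⟨hr.1, hr.2.trans_le hxy⟩
  have hlt : ∀ r ∈ R, ∀ x y, x ≤ r → r < y → c x < c y := by
    intro r hr x y hx hy
    refine Finset.card_lt_card (Finset.ssubset_iff_of_subset ?_ |>.2 ⟨r, ?_, ?_⟩)
    · intro r' hr'
      simp only [Finset.mem_filter] at hr' ⊢
      exact ⟨hr'.1, by omega⟩
    · simp [hr, hy]
    · simp [hx]
  have hcard : ∀ x ∈ A, c x < R.card := by
    intro x hx
    obtain ⟨r, hr, hxr⟩ := exists_rightEnd_ge hx
    exact Finset.card_lt_card (Finset.filter_ssubset.2 ⟨r, hr, by omega⟩)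
  have himage : R.image c = Finset.range R.card := by
    apply Finset.eq_of_subset_of_card_le
    · intro i hi
      obtain ⟨r, hr, rfl⟩ := Finset.mem_image.1 hi
      exact Finset.mem_range.2 (hcard r (mem_rightEnds.1 hr).1)
    · rw [Finset.card_range, Finset.card_image_of_injOn]
      intro x hx y hy hxy
      by_contra hne
      rcases lt_or_gt_of_ne hne with h | h
      · exact (hlt x hx x y le_rfl h).ne hxy
      · exact (hlt y hy y x le_rfl h).ne hxy.symm
  have hAP : A = Finset.univ.biUnion fun i : Fin R.card => A.filter fun x => c x = i := by
    ext x
    simp only [Finset.mem_biUnion, Finset.mem_univ, true_and, Finset.mem_filter]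
    exact ⟨fun hx => ⟨⟨c x, hcard x hx⟩, hx, rfl⟩, fun ⟨_, hx, _⟩ => hx⟩
  have hsep : ∀ i j : Fin R.card, i < j → ∀ x ∈ A.filter (fun x => c x = i),
      ∀ y ∈ A.filter (fun x => c x = j), x + 1 < y := by
    intro i j hij x hx y hy
    simp only [Finset.mem_filter] at hx hy
    have hcxy : c x < c y := by rw [hx.2, hy.2]; exact hij
    have hxy : x < y := hmono.reflect_lt hcxy
    rcases (Int.add_one_le_iff.2 hxy).eq_or_lt with h | h
    · exfalso
      have hsub : R.filter (· < y) ⊆ R.filter (· < x) := by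
        intro r hr
        simp only [Finset.mem_filter] at hr ⊢
        refine ⟨hr.1, lt_of_le_of_ne (by omega) ?_⟩
        rintro rfl
        exact (mem_rightEnds.1 hr.1).2 (h ▸ hy.1)
      exact absurd (Finset.card_le_card hsub) (not_le.2 hcxy)
    · exact h
  refine ⟨fun i => A.filter fun x => c x = i, ?_, hAP, hsep, ?_⟩
  · intro i
    obtain ⟨r, hr, hri⟩ := Finset.mem_image.1 (himage ▸ Finset.mem_range.2 i.2)
    have hne : (A.filter fun x => c x = i).Nonempty :=
      ⟨r, Finset.mem_filter.2 ⟨(mem_rightEnds.1 hr).1, hri⟩⟩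
    have hmin := Finset.mem_filter.1 (Finset.min'_mem _ hne)
    have hmax := Finset.mem_filter.1 (Finset.max'_mem _ hne)
    refine ⟨_, _, Finset.min'_le_max' _ hne, ?_⟩
    ext x
    rw [Finset.mem_Icc]
    constructor
    · exact fun hx => ⟨Finset.min'_le _ _ hx, Finset.le_max' _ _ hx⟩
    · rintro ⟨h1, h2⟩
      refine Finset.mem_filter.2 ⟨?_, ?_⟩
      · by_contra hx
        obtain ⟨r, hr, h3, h4⟩ := exists_rightEnd hmin.1 h1 hx
        have := hlt r hr _ _ h3 (h4.trans_le h2)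
        omega
      · have h3 := hmono h1
        have h4 := hmono h2
        omega
  · by_contra! hall
    have : A.card ≤ R.card := by
      conv_lhs => rw [hAP]
      simpa using Finset.card_biUnion_le_card_mul Finset.univ
        (fun i : Fin R.card => A.filter fun x => c x = i) 1 fun i _ => hall i
    omega

/-- If the bound `vol(B) ≤ 2^(n-1) (|B| - n) + 1` holds for one-dimensional sets with exactly `n`
segments, then the analogous bound holds for those with `t ≤ n` segments. -/
lemma HasVolume.le_of_card_rightEnds_le {n : ℕ}
    (hn : ∀ B : Finset ℤ, HasAddDim B 1 → IsLeast {t : ℕ | UnionOfSegments B t} n →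
      n + 1 ≤ B.card → ∀ w : ℕ, HasVolume B w → w ≤ 2 ^ (n - 1) * (B.card - n) + 1)
    {A : Finset ℤ} (hA : IsPinned A) (hcard : 3 ≤ A.card) (hR : (rightEnds A).card < A.card)
    (hle : (rightEnds A).card ≤ n) {v : ℕ} (hv : HasVolume A v) :
    v ≤ 2 ^ ((rightEnds A).card - 1) * (A.card - (rightEnds A).card) + 1 := by
  obtain ⟨d, hd⟩ := Nat.exists_eq_add_of_le hle
  clear hle
  induction d generalizing A v with
  | zero =>
    obtain rfl : n = (rightEnds A).card := hd
    exact hn A hA.hasAddDim ⟨unionOfSegments_card_rightEnds hR, fun t ⟨P, hP⟩ =>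
      card_rightEnds_le hP.1 hP.2.1⟩ hR v hv
  | succ d ih =>
    have hne : A.Nonempty := Finset.card_pos.1 (by omega)
    obtain ⟨m, hm, hmin⟩ := A.exists_min_image id hne
    obtain ⟨M, hM, hmax⟩ := A.exists_max_image id hne
    simp only [id] at hmin hmax
    have hdiam : 2 ≤ M - m := by
      have hsub : A ⊆ Finset.Icc m M := fun x hx => Finset.mem_Icc.2 ⟨hmin x hx, hmax x hx⟩
      have := Finset.card_le_card hsub
      rw [Int.card_Icc] at this
      omega
    have hnew : 2 * M - m ∉ A := fun h => by
      have := hmax _ h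
      omega
    have hRE : rightEnds (insert (2 * M - m) A) = insert (2 * M - m) (rightEnds A) := by
      ext x
      simp only [mem_rightEnds, Finset.mem_insert]
      constructor
      · rintro ⟨rfl | hx, h⟩
        · exact Or.inl rfl
        · exact Or.inr ⟨hx, fun h' => h (Or.inr h')⟩
      · rintro (rfl | ⟨hx, h⟩)
        · refine ⟨Or.inl rfl, ?_⟩
          rintro (h | h)
          · omega
          · have := hmax _ h
            omega
        · refine ⟨Or.inr hx, ?_⟩
          rintro (h' | h')
          · have := hmax _ hx
            omega
          · exact h h'
    have hREcard : (rightEnds (insert (2 * M - m) A)).card = (rightEnds A).card + 1 := by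
      rw [hRE, Finset.card_insert_of_notMem fun h => hnew (mem_rightEnds.1 h).1]
    have hAcard : (insert (2 * M - m) A).card = A.card + 1 := Finset.card_insert_of_notMem hnew
    have hA' := hA.insert_reflection hm hM
    obtain ⟨v', hv'⟩ := hA'.hasAddDim.exists_hasVolume
    have hbound := ih hA' (by omega) (by omega) hv' (by omega)
    have hratio := HasVolume.mul_le_mul_of_subset hA hA' (Finset.subset_insert _ _) hv hv' hm hM
      (fun x hx => ⟨hmin x hx, hmax x hx⟩) (Finset.mem_insert_of_mem hm)
      (Finset.mem_insert_self _ _) (by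
        intro x hx
        rcases Finset.mem_insert.1 hx with rfl | hx
        · omega
        · have := hmin x hx
          have := hmax x hx
          omega)
    have h2 : 2 * ((v : ℤ) - 1) ≤ v' - 1 := by
      refine le_of_mul_le_mul_right ?_ (by omega : 0 < M - m)
      linarith
    have hpos : 0 < (rightEnds A).card := by
      obtain ⟨r, hr, -⟩ := exists_rightEnd_ge hm
      exact Finset.card_pos.2 ⟨r, hr⟩
    rw [hREcard, hAcard] at hbound
    obtain ⟨t, ht⟩ : ∃ t, (rightEnds A).card = t + 1 := ⟨_, (Nat.succ_pred_eq_of_pos hpos).symm⟩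
    rw [ht] at hbound ⊢
    simp only [Nat.add_sub_cancel, Nat.add_sub_add_right, pow_succ] at hbound ⊢
    rw [mul_right_comm] at hbound
    omega

lemma two_pow_mul_le {t K k s : ℕ} (ht : 0 < t) (hts : t < s) (hsk : s < k)
    (hK : K + s + 1 ≤ 2 * k) : 2 ^ (t - 1) * (K - t) ≤ 2 ^ (s - 1) * (k - s) := by
  obtain ⟨u, rfl⟩ : ∃ u, s = t + u + 1 := ⟨s - t - 1, by omega⟩
  have hpow : 2 ^ (t + u + 1 - 1) = 2 ^ (t - 1) * 2 ^ (u + 1) := by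
    rw [← pow_add]
    congr 1
    omega
  rw [hpow, mul_assoc]
  refine Nat.mul_le_mul_left _ ?_
  obtain ⟨l, hl⟩ : ∃ l, k - (t + u + 1) = l + 1 := ⟨k - (t + u + 1) - 1, by omega⟩
  have hu : u < 2 ^ u := Nat.lt_two_pow_self
  rw [hl, pow_succ]
  have : K - t ≤ 2 * (l + 1) + u := by omega
  nlinarith [Nat.zero_le (l * (2 ^ u - 1)), Nat.mul_le_mul_left l (show 1 ≤ 2 ^ u by omega)]

/-- Lemma 3.1: if Conjecture 1.2 holds for `s - 1` and `vol(A) > 2^(s-1)(k-s)+1`, then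
`max(Pᵢ + Pⱼ) < min(Pᵢ + Pⱼ₊₁)` for all `1 ≤ i ≤ s` and `1 ≤ j < s`. -/
theorem sums_separated_of_large_volume (A : Finset ℤ) (k s : ℕ)
    (hk : A.card = k) (hsk : s + 1 ≤ k)
    (hd : HasAddDim A 1)
    (P : Fin s → Finset ℤ)
    (hseg : ∀ i, ∃ a b : ℤ, a ≤ b ∧ P i = Finset.Icc a b)
    (hA : A = Finset.univ.biUnion P)
    (hsep : ∀ i j : Fin s, i < j → ∀ x ∈ P i, ∀ y ∈ P j, x < y)
    (hind : ∀ B : Finset ℤ, HasAddDim B 1 →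
      IsLeast {t : ℕ | UnionOfSegments B t} (s - 1) → (s - 1) + 1 ≤ B.card →
      ∀ w : ℕ, HasVolume B w → w ≤ 2 ^ (s - 2) * (B.card - (s - 1)) + 1)
    (v : ℕ) (hv : HasVolume A v) (hvbig : 2 ^ (s - 1) * (k - s) + 1 < v) :
    ∀ i j : Fin s, ∀ hj : (j : ℕ) + 1 < s,
      ∀ x ∈ P i + P j, ∀ y ∈ P i + P ⟨(j : ℕ) + 1, hj⟩, x < y := by
  intro i j hj x hx y hy
  by_contra! hyx
  choose a b hab hP using hseg
  set j' : Fin s := ⟨(j : ℕ) + 1, hj⟩ with hj'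
  have hjj' : j < j' := Fin.lt_def.2 (Nat.lt_succ_self _)
  have hmemA : ∀ l, ∀ z, a l ≤ z → z ≤ b l → z ∈ A := fun l z h1 h2 => by
    rw [hA]
    exact Finset.mem_biUnion.2 ⟨l, Finset.mem_univ l, hP l ▸ Finset.mem_Icc.2 ⟨h1, h2⟩⟩
  have hgap : b j < a j' := hsep j j' hjj' _ (by simp [hP, hab]) _ (by simp [hP, hab])
  have hoverlap : a j' - b j ≤ b i - a i := by
    obtain ⟨x₁, hx₁, x₂, hx₂, rfl⟩ := Finset.mem_add.1 hx
    obtain ⟨y₁, hy₁, y₂, hy₂, rfl⟩ := Finset.mem_add.1 hy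
    rw [hP, Finset.mem_Icc] at hx₁ hx₂ hy₁ hy₂
    omega
  have hPi : (P i).card + (s - 1) ≤ k := by
    have hdisj : ∀ p ∈ Finset.univ, ∀ q ∈ Finset.univ, p ≠ q → Disjoint (P p) (P q) := by
      intro p _ q _ hpq
      refine Finset.disjoint_left.2 fun z hz hz' => ?_
      rcases lt_or_gt_of_ne hpq with h | h
      · exact (hsep p q h z hz z hz').false
      · exact (hsep q p h z hz' z hz).false
    have hsum : k = ∑ l, (P l).card := by rw [← hk, hA, Finset.card_biUnion hdisj]
    have hone : s - 1 ≤ ∑ l ∈ Finset.univ.erase i, (P l).card := by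
      have := Finset.card_nsmul_le_sum (Finset.univ.erase i) (fun l => (P l).card) 1 fun l _ =>
        Finset.card_pos.2 ⟨a l, by simp [hP, hab]⟩
      simpa using this
    rw [hsum, ← Finset.add_sum_erase _ _ (Finset.mem_univ i)]
    omega
  rw [hP, Int.card_Icc] at hPi
  have hpin := hd.isPinned
  have hbj : b j ∈ A := hmemA j _ (hab j) le_rfl
  have haj' : a j' ∈ A := hmemA j' _ le_rfl (hab j')
  have hpin' := hpin.union_Ioo hbj haj' hgap
  set A' := A ∪ Finset.Ioo (b j) (a j') with hA'
  have hsub : A ⊆ A' := Finset.subset_union_left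
  have hcard : k ≤ A'.card := hk ▸ Finset.card_le_card hsub
  have hcard' : A'.card + s + 1 ≤ 2 * k := by
    have : A'.card ≤ _ := Finset.card_union_le A (Finset.Ioo (b j) (a j'))
    rw [Int.card_Ioo, hk] at this
    omega
  have hRE : (rightEnds A').card ≤ s - 1 := by
    have hsubR : rightEnds A' ⊆ (Finset.univ.erase j).image b := by
      intro z hz
      obtain ⟨hz, hz1⟩ := mem_rightEnds.1 hz
      simp only [hA', Finset.mem_union, Finset.mem_Ioo, not_or] at hz hz1
      have hzA : z ∈ A := hz.resolve_right fun h => by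
        rcases (Int.add_one_le_iff.2 h.2).eq_or_lt with h' | h'
        · exact hz1.1 (h' ▸ haj')
        · exact hz1.2 ⟨by omega, h'⟩
      rw [hA] at hzA
      obtain ⟨l, -, hl⟩ := Finset.mem_biUnion.1 hzA
      rw [hP, Finset.mem_Icc] at hl
      have hzb : z = b l := by
        by_contra hne
        exact hz1.1 (hmemA l _ (by omega) (by omega))
      refine Finset.mem_image.2 ⟨l, Finset.mem_erase.2 ⟨?_, Finset.mem_univ l⟩, hzb.symm⟩
      rintro rfl
      rcases (Int.add_one_le_iff.2 hgap).eq_or_lt with h' | h'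
      · exact hz1.1 (by rw [hzb, h']; exact haj')
      · exact hz1.2 ⟨by omega, by omega⟩
    calc _ ≤ _ := Finset.card_le_card hsubR
      _ ≤ _ := Finset.card_image_le
      _ = s - 1 := by simp
  obtain ⟨v', hv'⟩ := hpin'.hasAddDim.exists_hasVolume
  have hbound := HasVolume.le_of_card_rightEnds_le (n := s - 1) hind hpin' (by omega) (by omega)
    hRE hv'
  have hpos : 0 < (rightEnds A').card := by
    obtain ⟨r, hr, -⟩ := exists_rightEnd_ge (hsub hbj)
    exact Finset.card_pos.2 ⟨r, hr⟩
  have hpow := two_pow_mul_le hpos (by omega) hsk hcard'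
  obtain ⟨m, hm, hmin⟩ := A.exists_min_image id ⟨_, hbj⟩
  obtain ⟨M, hM, hmax⟩ := A.exists_max_image id ⟨_, hbj⟩
  simp only [id] at hmin hmax
  have hratio := HasVolume.mul_le_mul_of_subset hpin hpin' hsub hv hv' hm hM
    (fun z hz => ⟨hmin z hz, hmax z hz⟩) (hsub hm) (hsub hM) (by
      intro z hz
      rcases Finset.mem_union.1 hz with hz | hz
      · exact ⟨hmin z hz, hmax z hz⟩
      · rw [Finset.mem_Ioo] at hz
        exact ⟨(hmin _ hbj).trans hz.1.le, hz.2.le.trans (hmax _ haj')⟩)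
  have hvv' : (v : ℤ) - 1 ≤ v' - 1 := by
    refine le_of_mul_le_mul_right hratio (sub_pos.2 ?_)
    exact (hmin _ hbj).trans_lt (hgap.trans_le (hmax _ haj'))
  omega
end

section
/- Let A ⊆ ℤ be an extremal set of cardinality k which is the union of two segments. Then A is F₂-isomorphic to one of the following sets: (i) [0, k+b−1] \ [1, b] for some 1 ≤ b ≤ k−3, which has dim(A) = 1, vol(A) = k+b and |2A| = 2k−1+b; or (ii) ([0, k₁−1] × {0}) ∪ ([0, k₂−1] × {1}) ⊆ ℤ² with k₁ + k₂ = k and k₁, k₂ ≥ 1, which has dim(A) = 2, vol(A) = k and |2A| = 3k−3. -/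
open Pointwise

namespace F2Isomorphic

variable {G G' G'' : Type*} [AddCommGroup G] [AddCommGroup G'] [AddCommGroup G'']
  {A : Finset G} {B : Finset G'} {C : Finset G''}

theorem symm (h : F2Isomorphic A B) : F2Isomorphic B A := by
  obtain ⟨φ, hφ, hq⟩ := h
  have hinv := hφ.invOn_invFunOn
  have hbij := hinv.symm.bijOn hφ.surjOn.mapsTo_invFunOn hφ.mapsTo
  refine ⟨Function.invFunOn φ A, hbij, fun x hx y hy z hz t ht => ?_⟩
  rw [hq _ (hbij.mapsTo hx) _ (hbij.mapsTo hy) _ (hbij.mapsTo hz) _ (hbij.mapsTo ht),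
    hinv.2 hx, hinv.2 hy, hinv.2 hz, hinv.2 ht]

theorem trans (h : F2Isomorphic A B) (h' : F2Isomorphic B C) : F2Isomorphic A C := by
  obtain ⟨φ, hφ, hq⟩ := h
  obtain ⟨ψ, hψ, hr⟩ := h'
  refine ⟨ψ ∘ φ, hψ.comp hφ, fun x hx y hy z hz t ht => ?_⟩
  rw [hq x hx y hy z hz t ht]
  exact hr _ (hφ.mapsTo hx) _ (hφ.mapsTo hy) _ (hφ.mapsTo hz) _ (hφ.mapsTo ht)

theorem card_eq (h : F2Isomorphic A B) : A.card = B.card := by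
  obtain ⟨φ, hφ, -⟩ := h
  exact Finset.card_nbij φ hφ.mapsTo hφ.injOn hφ.surjOn

theorem card_add_le [DecidableEq G] [DecidableEq G'] (h : F2Isomorphic A B) :
    (B + B).card ≤ (A + A).card := by
  obtain ⟨φ, hφ, hq⟩ := h
  refine Finset.card_le_card_of_forall_subsingleton
    (fun s t => ∃ x ∈ A, ∃ y ∈ A, x + y = t ∧ φ x + φ y = s) ?_ ?_
  · intro s hs
    obtain ⟨u, hu, v, hv, rfl⟩ := Finset.mem_add.1 hs
    obtain ⟨x, hx, rfl⟩ := hφ.surjOn hu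
    obtain ⟨y, hy, rfl⟩ := hφ.surjOn hv
    exact ⟨x + y, Finset.add_mem_add hx hy, x, hx, y, hy, rfl, rfl⟩
  · rintro t - s ⟨-, x, hx, y, hy, rfl, rfl⟩ s' ⟨-, z, hz, w, hw, h, rfl⟩
    exact (hq x hx y hy z hz w hw).1 h.symm

theorem card_add_eq [DecidableEq G] [DecidableEq G'] (h : F2Isomorphic A B) :
    (A + A).card = (B + B).card :=
  le_antisymm h.symm.card_add_le h.card_add_le

theorem hasFullDimWitness {d : ℕ} (h : F2Isomorphic A B) (hB : HasFullDimWitness B d) :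
    HasFullDimWitness A d := by
  obtain ⟨C, hC, hd⟩ := hB
  exact ⟨C, h.trans hC, hd⟩

theorem hasAddDim {d : ℕ} (h : F2Isomorphic A B) (hB : HasAddDim B d) : HasAddDim A d :=
  ⟨h.hasFullDimWitness hB.1, fun d' hd' => hB.2 d' (h.symm.hasFullDimWitness hd')⟩

theorem hasVolume {v : ℕ} (h : F2Isomorphic A B) (hB : HasVolume B v) : HasVolume A v := by
  obtain ⟨d, hd, ⟨C, hC, hv⟩, hmin⟩ := hB
  refine ⟨d, h.hasAddDim hd, ⟨C, h.trans hC, hv⟩, ?_⟩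
  rintro n ⟨D, hD, hn⟩
  exact hmin ⟨D, h.symm.trans hD, hn⟩

end F2Isomorphic

theorem HasAddDim.unique {G : Type*} [AddCommGroup G] {A : Finset G} {d d' : ℕ}
    (h : HasAddDim A d) (h' : HasAddDim A d') : d = d' :=
  le_antisymm (h'.2 d h.1) (h.2 d' h'.1)

theorem HasVolume.unique {G : Type*} [AddCommGroup G] {A : Finset G} {v v' : ℕ}
    (h : HasVolume A v) (h' : HasVolume A v') : v = v' := by
  obtain ⟨d, hd, hv⟩ := h
  obtain ⟨d', hd', hv'⟩ := h'
  obtain rfl := hd.unique hd'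
  exact hv.unique hv'

/-- The lattice points counted by `hullCard`. -/
def hullLattice {d : ℕ} (B : Finset (Fin d → ℤ)) : Set (Fin d → ℤ) :=
  {x | (fun i => (x i : ℝ)) ∈ convexHull ℝ
    ((fun (v : Fin d → ℤ) (i : Fin d) => (v i : ℝ)) '' (B : Set (Fin d → ℤ)))}

theorem subset_hullLattice {d : ℕ} (B : Finset (Fin d → ℤ)) :
    (B : Set (Fin d → ℤ)) ⊆ hullLattice B :=
  fun x hx => subset_convexHull ℝ _ ⟨x, hx, rfl⟩

theorem finite_hullLattice {d : ℕ} (B : Finset (Fin d → ℤ)) : (hullLattice B).Finite := by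
  obtain ⟨hi, hhi⟩ := B.bddAbove
  obtain ⟨lo, hlo⟩ := B.bddBelow
  refine (Set.finite_Icc lo hi).subset fun x hx => ?_
  have hsub : convexHull ℝ ((fun (v : Fin d → ℤ) (i : Fin d) => (v i : ℝ)) '' (B : Set _)) ⊆
      Set.Icc (fun i => (lo i : ℝ)) (fun i => (hi i : ℝ)) := by
    refine convexHull_min ?_ (convex_Icc _ _)
    rintro _ ⟨v, hv, rfl⟩
    exact ⟨fun i => Int.cast_le.2 (hlo hv i), fun i => Int.cast_le.2 (hhi hv i)⟩
  have hx' := hsub hx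
  exact ⟨fun i => Int.cast_le.1 (hx'.1 i), fun i => Int.cast_le.1 (hx'.2 i)⟩

theorem card_le_hullCard {d : ℕ} {B C : Finset (Fin d → ℤ)}
    (h : (C : Set (Fin d → ℤ)) ⊆ hullLattice B) : C.card ≤ hullCard B := by
  rw [← Set.ncard_coe_finset C]
  exact Set.ncard_le_ncard h (finite_hullLattice B)

theorem hullCard_le_card {d : ℕ} {B C : Finset (Fin d → ℤ)}
    (h : hullLattice B ⊆ (C : Set (Fin d → ℤ))) : hullCard B ≤ C.card := by
  rw [← Set.ncard_coe_finset C]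
  exact Set.ncard_le_ncard h C.finite_toSet

/-- A set whose hull contains the endpoints of a progression contains the whole progression. -/
theorem add_zsmul_mem_hullLattice {d : ℕ} {B : Finset (Fin d → ℤ)} {x u : Fin d → ℤ} {N i : ℤ}
    (hx : x ∈ B) (hy : x + N • u ∈ B) (hi : 0 ≤ i) (hiN : i ≤ N) :
    x + i • u ∈ hullLattice B := by
  rcases (hi.trans hiN).eq_or_lt with rfl | hN
  · obtain rfl : i = 0 := le_antisymm hiN hi
    simpa using subset_hullLattice B hx
  have hN' : (0 : ℝ) < N := by exact_mod_cast hN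
  have hxB := subset_hullLattice B hx
  have hyB := subset_hullLattice B hy
  have hcomb := (convex_convexHull ℝ _) hxB hyB (a := 1 - (i : ℝ) / N) (b := (i : ℝ) / N)
    (sub_nonneg.2 ((div_le_one hN').2 (by exact_mod_cast hiN)))
    (div_nonneg (by exact_mod_cast hi) hN'.le) (by ring)
  change (fun j => ((x + i • u) j : ℝ)) ∈ convexHull ℝ _
  convert hcomb using 1
  funext j
  simp only [Pi.add_apply, Pi.smul_apply, smul_eq_mul]
  push_cast
  field_simp
  ring

/-- A linear form on `ℤ^d` vanishing on `m < d` given vectors. -/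
theorem exists_orthogonal {d m : ℕ} (hmd : m < d) (w : Fin m → Fin d → ℤ) :
    ∃ c : Fin d → ℤ, c ≠ 0 ∧ ∀ j, ∑ i, c i * w j i = 0 := by
  let f : (Fin d → ℤ) →ₗ[ℤ] (Fin m → ℤ) := Matrix.mulVecLin (Matrix.of w)
  have hf : ¬ Function.Injective f := fun h => by
    have := card_le_of_injective ℤ f h
    simp at this
    omega
  rw [injective_iff_map_eq_zero] at hf
  push Not at hf
  obtain ⟨c, hc, hc0⟩ := hf
  refine ⟨c, hc0, fun j => ?_⟩
  have := congrFun hc j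
  simpa [f, Matrix.mulVec, dotProduct, mul_comm] using this

theorem le_of_span {d m : ℕ} {B : Finset (Fin d → ℤ)} (hB : NotInAffineHyperplane B)
    (x₀ : Fin d → ℤ) (w : Fin m → Fin d → ℤ)
    (h : ∀ x ∈ B, ∃ a : Fin m → ℤ, x = x₀ + ∑ j, a j • w j) : d ≤ m := by
  by_contra! hmd
  obtain ⟨c, hc, hw⟩ := exists_orthogonal hmd w
  refine hc (hB c (∑ i, c i * x₀ i) fun x hx => ?_)
  obtain ⟨a, rfl⟩ := h x hx
  have hzero : c ⬝ᵥ (∑ j, a j • w j) = 0 := by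
    rw [dotProduct_sum]
    refine Finset.sum_eq_zero fun j _ => ?_
    rw [dotProduct_smul]
    simp [dotProduct, hw j]
  change c ⬝ᵥ (x₀ + ∑ j, a j • w j) = c ⬝ᵥ x₀
  rw [dotProduct_add, hzero, add_zero]

/-- Two segments of lengths `p` and `q`, separated by `b` holes, starting at `0`. -/
noncomputable def twoSeg (p q b : ℕ) : Finset ℤ :=
  Finset.Icc 0 ((p : ℤ) - 1) ∪ Finset.Icc ((p : ℤ) + b) ((p : ℤ) + q + b - 1)

theorem mem_twoSeg {p q b : ℕ} {x : ℤ} :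
    x ∈ twoSeg p q b ↔ (0 ≤ x ∧ x < p) ∨ ((p : ℤ) + b ≤ x ∧ x < p + q + b) := by
  simp only [twoSeg, Finset.mem_union, Finset.mem_Icc]
  omega

theorem card_twoSeg (p q b : ℕ) : (twoSeg p q b).card = p + q := by
  rw [twoSeg, Finset.card_union_of_disjoint]
  · simp only [Int.card_Icc]
    omega
  · rw [Finset.disjoint_left]
    simp only [Finset.mem_Icc]
    omega

theorem Icc_add_Icc_int {a b c d : ℤ} (hab : a ≤ b) (hcd : c ≤ d) :
    Finset.Icc a b + Finset.Icc c d = Finset.Icc (a + c) (b + d) := by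
  ext x
  simp only [Finset.mem_add, Finset.mem_Icc]
  constructor
  · rintro ⟨y, hy, z, hz, rfl⟩
    omega
  · intro hx
    exact ⟨max a (x - d), by omega, x - max a (x - d), by omega, by omega⟩

theorem twoSeg_add_twoSeg {p q b : ℕ} (hp : 1 ≤ p) (hq : 1 ≤ q) :
    twoSeg p q b + twoSeg p q b = Finset.Icc 0 (2 * (p : ℤ) - 2) ∪
      Finset.Icc ((p : ℤ) + b) (2 * p + q + b - 2) ∪
      Finset.Icc (2 * (p : ℤ) + 2 * b) (2 * p + 2 * q + 2 * b - 2) := by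
  rw [twoSeg, Finset.union_add, Finset.add_union, Finset.add_union, Icc_add_Icc_int,
    Icc_add_Icc_int, Icc_add_Icc_int, Icc_add_Icc_int]
  · ext x
    simp only [Finset.mem_union, Finset.mem_Icc]
    omega
  all_goals omega

theorem card_twoSeg_add_of_le_of_le {p q b : ℕ} (hq : 1 ≤ q) (hqp : q ≤ p) (h : p ≤ b + 1) :
    (twoSeg p q b + twoSeg p q b).card = 3 * (p + q) - 3 := by
  rw [twoSeg_add_twoSeg (hq.trans hqp) hq, Finset.card_union_of_disjoint,
    Finset.card_union_of_disjoint]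
  · simp only [Int.card_Icc]
    omega
  all_goals
    rw [Finset.disjoint_left]
    simp only [Finset.mem_union, Finset.mem_Icc]
    omega

theorem card_twoSeg_add_of_lt_of_le {p q b : ℕ} (hq : 1 ≤ q) (hp : b + 2 ≤ p) (h : q ≤ b + 1) :
    (twoSeg p q b + twoSeg p q b).card = 2 * (p + q) + q + b - 2 := by
  have hunion : twoSeg p q b + twoSeg p q b = Finset.Icc 0 (2 * (p : ℤ) + q + b - 2) ∪
      Finset.Icc (2 * (p : ℤ) + 2 * b) (2 * p + 2 * q + 2 * b - 2) := by
    rw [twoSeg_add_twoSeg (by omega) hq]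
    ext x
    simp only [Finset.mem_union, Finset.mem_Icc]
    omega
  rw [hunion, Finset.card_union_of_disjoint]
  · simp only [Int.card_Icc]
    omega
  · rw [Finset.disjoint_left]
    simp only [Finset.mem_Icc]
    omega

theorem card_twoSeg_add_of_lt_of_lt {p q b : ℕ} (hp : b + 2 ≤ p) (h : b + 2 ≤ q) :
    (twoSeg p q b + twoSeg p q b).card = 2 * (p + q) + 2 * b - 1 := by
  have hunion : twoSeg p q b + twoSeg p q b =
      Finset.Icc 0 (2 * (p : ℤ) + 2 * q + 2 * b - 2) := by
    rw [twoSeg_add_twoSeg (by omega) (by omega)]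
    ext x
    simp only [Finset.mem_union, Finset.mem_Icc]
    omega
  rw [hunion, Int.card_Icc]
  omega

section Rigidity

variable {G : Type*} [AddCommGroup G] {p q b : ℕ} {φ : ℤ → G}

theorem map_add_one (hp : 2 ≤ p)
    (hφ : ∀ x ∈ twoSeg p q b, ∀ y ∈ twoSeg p q b, ∀ z ∈ twoSeg p q b, ∀ t ∈ twoSeg p q b,
      (x + y = z + t ↔ φ x + φ y = φ z + φ t))
    {x : ℤ} (hx : x ∈ twoSeg p q b) (hx' : x + 1 ∈ twoSeg p q b) :
    φ (x + 1) = φ x + (φ 1 - φ 0) := by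
  have h := (hφ (x + 1) hx' 0 (mem_twoSeg.2 (by omega)) x hx 1 (mem_twoSeg.2 (by omega))).1
    (by ring)
  rw [← add_sub_assoc, ← h, add_sub_cancel_right]

theorem map_left (hp : 2 ≤ p)
    (hφ : ∀ x ∈ twoSeg p q b, ∀ y ∈ twoSeg p q b, ∀ z ∈ twoSeg p q b, ∀ t ∈ twoSeg p q b,
      (x + y = z + t ↔ φ x + φ y = φ z + φ t))
    (n : ℕ) (hn : n < p) : φ n = φ 0 + (n : ℤ) • (φ 1 - φ 0) := by
  induction n with
  | zero => simp
  | succ n ih =>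
    push_cast
    rw [map_add_one hp hφ (mem_twoSeg.2 (by omega)) (mem_twoSeg.2 (by omega)),
      ih (by omega), add_zsmul, one_zsmul, add_assoc]

theorem map_right (hp : 2 ≤ p)
    (hφ : ∀ x ∈ twoSeg p q b, ∀ y ∈ twoSeg p q b, ∀ z ∈ twoSeg p q b, ∀ t ∈ twoSeg p q b,
      (x + y = z + t ↔ φ x + φ y = φ z + φ t))
    (n : ℕ) (hn : n < q) :
    φ ((p : ℤ) + b + n) = φ ((p : ℤ) + b) + (n : ℤ) • (φ 1 - φ 0) := by
  induction n with
  | zero => simp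
  | succ n ih =>
    push_cast
    rw [← add_assoc, map_add_one hp hφ (mem_twoSeg.2 (by omega)) (mem_twoSeg.2 (by omega)),
      ih (by omega), add_zsmul, one_zsmul, add_assoc]

/-- If the gap is short, every Freiman homomorphism on `twoSeg` is affine. -/
theorem map_eq_affine (hq : 1 ≤ q) (hb : b + 2 ≤ p)
    (hφ : ∀ x ∈ twoSeg p q b, ∀ y ∈ twoSeg p q b, ∀ z ∈ twoSeg p q b, ∀ t ∈ twoSeg p q b,
      (x + y = z + t ↔ φ x + φ y = φ z + φ t))
    {x : ℤ} (hx : x ∈ twoSeg p q b) : φ x = φ 0 + x • (φ 1 - φ 0) := by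
  have hp : 2 ≤ p := by omega
  rcases mem_twoSeg.1 hx with h | h
  · lift x to ℕ using h.1
    exact map_left hp hφ x (by omega)
  · obtain ⟨n, rfl⟩ : ∃ n : ℕ, x = (p : ℤ) + b + n := ⟨(x - p - b).toNat, by omega⟩
    have hstart : φ ((p : ℤ) + b) = φ 0 + ((p : ℤ) + b) • (φ 1 - φ 0) := by
      have h1 := map_left hp hφ (p - 1) (by omega)
      have h2 := map_left hp hφ (b + 1) (by omega)
      have h3 := (hφ ((p : ℤ) + b) (mem_twoSeg.2 (by omega)) 0 (mem_twoSeg.2 (by omega))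
        ((p - 1 : ℕ) : ℤ) (mem_twoSeg.2 (by omega)) ((b + 1 : ℕ) : ℤ)
        (mem_twoSeg.2 (by omega))).1 (by omega)
      have h4 : ((p : ℤ) + b) = ((p - 1 : ℕ) : ℤ) + ((b + 1 : ℕ) : ℤ) := by omega
      rw [h1, h2] at h3
      rw [eq_sub_of_add_eq h3, h4, add_zsmul]
      abel
    rw [map_right hp hφ n (by omega), hstart, add_zsmul _ ((p : ℤ) + b), add_assoc]

end Rigidity

theorem f2Isomorphic_line (A : Finset ℤ) :
    F2Isomorphic A (A.image fun t => (fun _ : Fin 1 => t)) := by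
  refine ⟨fun t _ => t, ⟨?_, ?_, ?_⟩, ?_⟩
  · intro x hx
    simpa using ⟨x, hx, rfl⟩
  · intro x _ y _ h
    exact congrFun h 0
  · intro x hx
    simpa using hx
  · intro x _ y _ z _ t _
    exact ⟨fun h => funext fun _ => h, fun h => congrFun h 0⟩

theorem hasAddDim_one {p q b : ℕ} (hq : 1 ≤ q) (hb : b + 2 ≤ p) :
    HasAddDim (twoSeg p q b) 1 := by
  refine ⟨⟨_, f2Isomorphic_line _, ?_⟩, ?_⟩
  · intro c t h
    have h0 := h (fun _ => 0) (Finset.mem_image_of_mem _ (mem_twoSeg.2 (by omega)))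
    have h1 := h (fun _ => 1) (Finset.mem_image_of_mem _ (mem_twoSeg.2 (by omega)))
    funext i
    fin_cases i
    simp at h0 h1 ⊢
    omega
  · rintro d ⟨B, ⟨φ, hφ, hφq⟩, hB⟩
    refine le_of_span hB (φ 0) (fun _ : Fin 1 => φ 1 - φ 0) fun x hx => ?_
    obtain ⟨a, ha, rfl⟩ := hφ.surjOn hx
    exact ⟨fun _ => a, by simpa using map_eq_affine hq hb hφq ha⟩

theorem le_hullCard_of_f2Isomorphic {p q b d : ℕ} (hq : 1 ≤ q) (hb : b + 2 ≤ p)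
    {B : Finset (Fin d → ℤ)} (h : F2Isomorphic (twoSeg p q b) B) :
    p + q + b ≤ hullCard B := by
  obtain ⟨φ, hφ, hφq⟩ := h
  have h0 : (0 : ℤ) ∈ twoSeg p q b := mem_twoSeg.2 (by omega)
  have h1 : (1 : ℤ) ∈ twoSeg p q b := mem_twoSeg.2 (by omega)
  have hN : ((p : ℤ) + q + b - 1) ∈ twoSeg p q b := mem_twoSeg.2 (by omega)
  have hu : φ 1 - φ 0 ≠ 0 := fun h =>
    absurd (hφ.injOn h1 h0 (sub_eq_zero.1 h)) one_ne_zero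
  have hinj : Function.Injective fun i : ℤ => φ 0 + i • (φ 1 - φ 0) := fun i j hij =>
    smul_left_injective ℤ hu (add_left_cancel hij)
  have hcard := card_le_hullCard (B := B)
    (C := (Finset.Icc (0 : ℤ) ((p : ℤ) + q + b - 1)).image
      fun i : ℤ => φ 0 + i • (φ 1 - φ 0)) (by
        intro y hy
        simp only [Finset.coe_image, Finset.coe_Icc, Set.mem_image, Set.mem_Icc] at hy
        obtain ⟨i, hi, rfl⟩ := hy
        refine add_zsmul_mem_hullLattice (hφ.mapsTo h0) ?_ hi.1 hi.2
        rw [← map_eq_affine hq hb hφq hN]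
        exact hφ.mapsTo hN)
  rw [Finset.card_image_of_injective _ hinj, Int.card_Icc] at hcard
  omega

theorem hasVolume_of_short_gap {p q b : ℕ} (hq : 1 ≤ q) (hb : b + 2 ≤ p) :
    HasVolume (twoSeg p q b) (p + q + b) := by
  refine ⟨1, hasAddDim_one hq hb, ⟨_, f2Isomorphic_line _, le_antisymm ?_ ?_⟩, ?_⟩
  · refine (hullCard_le_card (C := (Finset.Icc (0 : ℤ) ((p : ℤ) + q + b - 1)).image
      fun t => (fun _ : Fin 1 => t)) fun x hx => ?_).trans ?_
    · have hsub := convexHull_min (s := (fun (v : Fin 1 → ℤ) (i : Fin 1) => (v i : ℝ)) ''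
          (((twoSeg p q b).image fun t => (fun _ : Fin 1 => t) : Finset _) : Set (Fin 1 → ℤ)))
        (t := Set.Icc (fun _ => (0 : ℝ)) (fun _ => (((p : ℤ) + q + b - 1 : ℤ) : ℝ))) (by
          rintro _ ⟨v, hv, rfl⟩
          obtain ⟨a, ha, rfl⟩ := Finset.mem_image.1 hv
          rw [mem_twoSeg] at ha
          exact ⟨fun _ => Int.cast_nonneg (show 0 ≤ a by omega),
            fun _ => Int.cast_le.2 (show a ≤ (p : ℤ) + q + b - 1 by omega)⟩)
        (convex_Icc (𝕜 := ℝ) _ _)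
      have hx' := hsub hx
      have hlo : 0 ≤ x 0 := Int.cast_nonneg_iff.1 (hx'.1 0)
      have hhi : x 0 ≤ (p : ℤ) + q + b - 1 := Int.cast_le.1 (hx'.2 0)
      refine Finset.mem_coe.2 (Finset.mem_image.2 ⟨x 0, Finset.mem_Icc.2 ⟨hlo, hhi⟩, ?_⟩)
      funext i
      fin_cases i
      rfl
    · refine Finset.card_image_le.trans ?_
      rw [Int.card_Icc]
      omega
  · exact le_hullCard_of_f2Isomorphic hq hb (f2Isomorphic_line _)
  · rintro n ⟨B, hB, rfl⟩
    exact le_hullCard_of_f2Isomorphic hq hb hB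

/-- Two parallel segments of lengths `p` and `q` on adjacent lines. -/
noncomputable def twoLines (p q : ℕ) : Finset (ℤ × ℤ) :=
  ((Finset.Icc (0 : ℤ) ((p : ℤ) - 1)).image (fun t => (t, (0 : ℤ)))) ∪
    ((Finset.Icc (0 : ℤ) ((q : ℤ) - 1)).image (fun t => (t, (1 : ℤ))))

theorem mem_twoLines {p q : ℕ} {x : ℤ × ℤ} :
    x ∈ twoLines p q ↔
      (0 ≤ x.1 ∧ x.1 < p ∧ x.2 = 0) ∨ (0 ≤ x.1 ∧ x.1 < q ∧ x.2 = 1) := by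
  obtain ⟨s, t⟩ := x
  simp only [twoLines, Finset.mem_union, Finset.mem_image, Finset.mem_Icc, Prod.mk.injEq]
  constructor
  · rintro (⟨a, ha, rfl, rfl⟩ | ⟨a, ha, rfl, rfl⟩) <;> omega
  · rintro (h | h)
    · exact Or.inl ⟨s, by omega, rfl, by omega⟩
    · exact Or.inr ⟨s, by omega, rfl, by omega⟩

/-- If the gap is long, the two segments can be placed on separate lines. -/
theorem f2Isomorphic_twoLines {p q b : ℕ} (hqp : q ≤ p) (hb : p ≤ b + 1) :
    F2Isomorphic (twoSeg p q b) (twoLines p q) := by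
  refine ⟨fun t => if t < p then (t, 0) else (t - p - b, 1), ⟨?_, ?_, ?_⟩, ?_⟩
  · intro x hx
    rw [Finset.mem_coe, mem_twoSeg] at hx
    rw [Finset.mem_coe, mem_twoLines]
    dsimp only
    split_ifs <;> simp <;> omega
  · intro x hx y hy h
    rw [Finset.mem_coe, mem_twoSeg] at hx hy
    dsimp only at h
    split_ifs at h <;> simp at h <;> omega
  · rintro ⟨s, t⟩ hx
    rw [Finset.mem_coe, mem_twoLines] at hx
    dsimp only at hx
    rcases hx with ⟨h0, h1, rfl⟩ | ⟨h0, h1, rfl⟩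
    · exact ⟨s, mem_twoSeg.2 (by omega), if_pos h1⟩
    · refine ⟨s + p + b, mem_twoSeg.2 (by omega), ?_⟩
      dsimp only
      rw [if_neg (by omega), Prod.mk.injEq]
      exact ⟨by ring, rfl⟩
  · intro x hx y hy z hz t ht
    rw [mem_twoSeg] at hx hy hz ht
    dsimp only
    split_ifs <;> simp only [Prod.mk_add_mk, Prod.mk.injEq, and_true] <;> omega

theorem f2Isomorphic_plane (A : Finset (ℤ × ℤ)) :
    F2Isomorphic A (A.image fun t => ![t.1, t.2]) := by
  refine ⟨fun t => ![t.1, t.2], ⟨?_, ?_, ?_⟩, ?_⟩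
  · intro x hx
    exact Finset.mem_coe.2 (Finset.mem_image_of_mem _ hx)
  · intro x _ y _ h
    exact Prod.ext (congrFun h 0) (congrFun h 1)
  · intro x hx
    simpa using hx
  · intro x _ y _ z _ t _
    simp [Prod.ext_iff]

theorem hasAddDim_two {p q b : ℕ} (hp : 2 ≤ p) (hq : 1 ≤ q) (hqp : q ≤ p) (hb : p ≤ b + 1) :
    HasAddDim (twoSeg p q b) 2 := by
  refine ⟨⟨_, (f2Isomorphic_twoLines hqp hb).trans (f2Isomorphic_plane _), ?_⟩, ?_⟩
  · intro c t h
    have h0 := h ![0, 0] (Finset.mem_image.2 ⟨(0, 0), mem_twoLines.2 (by simp; omega), rfl⟩)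
    have h1 := h ![1, 0] (Finset.mem_image.2 ⟨(1, 0), mem_twoLines.2 (by simp; omega), rfl⟩)
    have h2 := h ![0, 1] (Finset.mem_image.2 ⟨(0, 1), mem_twoLines.2 (by simp; omega), rfl⟩)
    simp [Fin.sum_univ_two] at h0 h1 h2
    funext i
    fin_cases i <;> simp <;> omega
  · rintro d ⟨B, ⟨φ, hφ, hφq⟩, hB⟩
    refine le_of_span hB (φ 0) ![φ 1 - φ 0, φ ((p : ℤ) + b) - φ 0] fun x hx => ?_
    obtain ⟨a, ha, rfl⟩ := hφ.surjOn hx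
    rcases mem_twoSeg.1 ha with h | h
    · lift a to ℕ using h.1
      refine ⟨![a, 0], ?_⟩
      simpa [Fin.sum_univ_two] using map_left hp hφq a (by omega)
    · obtain ⟨n, rfl⟩ : ∃ n : ℕ, a = (p : ℤ) + b + n := ⟨(a - p - b).toNat, by omega⟩
      refine ⟨![n, 1], ?_⟩
      rw [map_right hp hφq n (by omega)]
      simp only [Fin.sum_univ_two, Matrix.cons_val_zero, Matrix.cons_val_one, one_zsmul]
      abel

theorem hullLattice_twoLines_subset {p q : ℕ} :
    hullLattice ((twoLines p q).image fun t => ![t.1, t.2]) ⊆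
      (((twoLines p q).image fun t => ![t.1, t.2] : Finset _) : Set (Fin 2 → ℤ)) := by
  intro x hx
  let S : Set (Fin 2 → ℝ) := {v | 0 ≤ v 0 ∧ 0 ≤ v 1 ∧ v 1 ≤ 1 ∧
    v 0 ≤ (1 - v 1) * ((p : ℝ) - 1) + v 1 * ((q : ℝ) - 1)}
  have hS : Convex ℝ S := by
    rintro v ⟨v1, v2, v3, v4⟩ w ⟨w1, w2, w3, w4⟩ α β hα hβ hαβ
    obtain rfl : β = 1 - α := by linarith
    simp only [S, Set.mem_ofPred_eq, Pi.add_apply, Pi.smul_apply, smul_eq_mul]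
    refine ⟨by positivity, by positivity, by nlinarith, ?_⟩
    linear_combination α * v4 + (1 - α) * w4
  have hsub := convexHull_min (s := (fun (v : Fin 2 → ℤ) (i : Fin 2) => (v i : ℝ)) ''
      (((twoLines p q).image fun t => ![t.1, t.2] : Finset _) : Set (Fin 2 → ℤ))) (t := S) (by
    rintro _ ⟨v, hv, rfl⟩
    obtain ⟨⟨s, t⟩, ha, rfl⟩ := Finset.mem_image.1 hv
    rw [mem_twoLines] at ha
    dsimp only at ha
    simp only [S, Set.mem_ofPred_eq, Matrix.cons_val_zero, Matrix.cons_val_one]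
    rcases ha with ⟨h0, h1, rfl⟩ | ⟨h0, h1, rfl⟩
    · have h2 : (s : ℝ) ≤ p - 1 := by exact_mod_cast Int.le_sub_one_of_lt h1
      exact ⟨by exact_mod_cast h0, by simp, by simp, by simpa using h2⟩
    · have h2 : (s : ℝ) ≤ q - 1 := by exact_mod_cast Int.le_sub_one_of_lt h1
      exact ⟨by exact_mod_cast h0, by simp, by simp, by simpa using h2⟩) hS
  obtain ⟨h1, h2, h3, h4⟩ := hsub hx
  dsimp only at h1 h2 h3 h4
  have e1 : 0 ≤ x 0 := by exact_mod_cast h1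
  have e2 : 0 ≤ x 1 := by exact_mod_cast h2
  have e3 : x 1 ≤ 1 := by exact_mod_cast h3
  have e4 : x 0 ≤ (1 - x 1) * ((p : ℤ) - 1) + x 1 * ((q : ℤ) - 1) := by
    have h5 : ((x 0 : ℤ) : ℝ) ≤ (((1 - x 1) * ((p : ℤ) - 1) + x 1 * ((q : ℤ) - 1) : ℤ) : ℝ) := by
      push_cast
      exact h4
    exact Int.cast_le.1 h5
  refine Finset.mem_coe.2 (Finset.mem_image.2 ⟨(x 0, x 1), mem_twoLines.2 ?_, ?_⟩)
  · obtain h | h : x 1 = 0 ∨ x 1 = 1 := by omega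
    · rw [h] at e4
      exact Or.inl ⟨e1, by linarith, h⟩
    · rw [h] at e4
      exact Or.inr ⟨e1, by linarith, h⟩
  · funext i
    fin_cases i <;> rfl

theorem hasVolume_of_long_gap {p q b : ℕ} (hp : 2 ≤ p) (hq : 1 ≤ q) (hqp : q ≤ p)
    (hb : p ≤ b + 1) : HasVolume (twoSeg p q b) (p + q) := by
  have hiso := (f2Isomorphic_twoLines hqp hb).trans (f2Isomorphic_plane _)
  have hlow : ∀ B : Finset (Fin 2 → ℤ), F2Isomorphic (twoSeg p q b) B → p + q ≤ hullCard B := by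
    intro B hB
    rw [← card_twoSeg p q b, hB.card_eq]
    exact card_le_hullCard (subset_hullLattice B)
  refine ⟨2, hasAddDim_two hp hq hqp hb, ⟨_, hiso, le_antisymm ?_ (hlow _ hiso)⟩, ?_⟩
  · rw [← card_twoSeg p q b, hiso.card_eq]
    exact hullCard_le_card hullLattice_twoLines_subset
  · rintro n ⟨B, hB, rfl⟩
    exact hlow B hB

theorem f2Isomorphic_reflect (m b : ℕ) (hm : 1 ≤ m) :
    F2Isomorphic (twoSeg m 1 b)
      (Finset.Icc (0 : ℤ) (((m + 1 : ℕ) : ℤ) + b - 1) \ Finset.Icc (1 : ℤ) (b : ℤ)) := by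
  refine ⟨fun t => m + b - t, ⟨?_, ?_, ?_⟩, ?_⟩
  · intro x hx
    rw [Finset.mem_coe, mem_twoSeg] at hx
    simp only [Finset.mem_coe, Finset.mem_sdiff, Finset.mem_Icc]
    omega
  · intro x _ y _ h
    dsimp only at h
    omega
  · intro x hx
    simp only [Finset.mem_coe, Finset.mem_sdiff, Finset.mem_Icc] at hx
    exact ⟨m + b - x, mem_twoSeg.2 (by omega), by ring⟩
  · intro x _ y _ z _ t _
    dsimp only
    omega

/-- Up to translation and reflection, the longer segment comes first. -/
theorem UnionOfSegments.exists_f2Isomorphic_twoSeg {A : Finset ℤ} (h : UnionOfSegments A 2) :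
    ∃ p q b : ℕ, 2 ≤ p ∧ 1 ≤ q ∧ q ≤ p ∧ 1 ≤ b ∧ F2Isomorphic A (twoSeg p q b) := by
  obtain ⟨P, hP, hA, hsep, i, hi⟩ := h
  obtain ⟨a, c, hac, h0⟩ := hP 0
  obtain ⟨e, f, hef, h1⟩ := hP 1
  have hgap : c + 1 < e := hsep 0 1 (by decide) c (by simp [h0, hac]) e (by simp [h1, hef])
  have hlong : a < c ∨ e < f := by
    fin_cases i
    · left
      simp [h0] at hi
      omega
    · right
      simp [h1] at hi
      omega
  have hmem : ∀ x, x ∈ A ↔ (a ≤ x ∧ x ≤ c) ∨ (e ≤ x ∧ x ≤ f) := by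
    intro x
    simp [hA, Fin.exists_fin_two, h0, h1]
  rcases le_total (f - e) (c - a) with hle | hle
  · refine ⟨(c - a + 1).toNat, (f - e + 1).toNat, (e - c - 1).toNat, by omega, by omega,
      by omega, by omega, fun t => t - a, ⟨?_, ?_, ?_⟩, ?_⟩
    · intro x hx
      rw [Finset.mem_coe, hmem] at hx
      rw [Finset.mem_coe, mem_twoSeg]
      dsimp only
      omega
    · intro x _ y _ h
      dsimp only at h
      omega
    · intro x hx
      rw [Finset.mem_coe, mem_twoSeg] at hx
      exact ⟨x + a, (hmem _).2 (by omega), by ring⟩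
    · intro x _ y _ z _ t _
      dsimp only
      omega
  · refine ⟨(f - e + 1).toNat, (c - a + 1).toNat, (e - c - 1).toNat, by omega, by omega,
      by omega, by omega, fun t => f - t, ⟨?_, ?_, ?_⟩, ?_⟩
    · intro x hx
      rw [Finset.mem_coe, hmem] at hx
      rw [Finset.mem_coe, mem_twoSeg]
      dsimp only
      omega
    · intro x _ y _ h
      dsimp only at h
      omega
    · intro x hx
      rw [Finset.mem_coe, mem_twoSeg] at hx
      exact ⟨f - x, (hmem _).2 (by omega), by ring⟩
    · intro x _ y _ z _ t _
      dsimp only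
      omega

/-- In dimension one, an extremal set has volume at least that of any `[0, m-1] ∪ {m+b}` with
the same cardinality and the same doubling. -/
theorem IsExtremal.le_of_hasVolume {A : Finset ℤ} {m b v : ℕ} (h : IsExtremal A)
    (hdim : HasAddDim A 1) (hvol : HasVolume A v) (hb : b + 2 ≤ m) (hcard : A.card = m + 1)
    (hadd : (A + A).card = 2 * m + 1 + b) : m + 1 + b ≤ v := by
  obtain ⟨d, v', hd, hv', hmax⟩ := h
  obtain rfl := hd.unique hdim
  obtain rfl := hv'.unique hvol
  refine hmax.2 ⟨twoSeg m 1 b, fun a ha => ?_, ?_, ?_, hasAddDim_one le_rfl hb,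
    hasVolume_of_short_gap le_rfl hb⟩
  · rw [mem_twoSeg] at ha
    omega
  · rw [card_twoSeg, hcard]
  · rw [card_twoSeg_add_of_lt_of_le le_rfl hb (by omega), hadd]
    omega

/-- Lemma 4.4: structure of extremal sets composed of two segments. -/
theorem extremal_two_segments (A : Finset ℤ) (k : ℕ) (hk : A.card = k)
    (hseg : UnionOfSegments A 2) (hext : IsExtremal A) :
    (∃ b : ℕ, 1 ≤ b ∧ b + 3 ≤ k ∧
      F2Isomorphic A (Finset.Icc (0 : ℤ) ((k : ℤ) + b - 1) \ Finset.Icc (1 : ℤ) (b : ℤ)) ∧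
      HasAddDim A 1 ∧ HasVolume A (k + b) ∧ (A + A).card = 2 * k - 1 + b) ∨
    (∃ k₁ k₂ : ℕ, k₁ + k₂ = k ∧ 1 ≤ k₁ ∧ 1 ≤ k₂ ∧
      F2Isomorphic A
        (((Finset.Icc (0 : ℤ) ((k₁ : ℤ) - 1)).image (fun t => (t, (0 : ℤ)))) ∪
         ((Finset.Icc (0 : ℤ) ((k₂ : ℤ) - 1)).image (fun t => (t, (1 : ℤ))))) ∧
      HasAddDim A 2 ∧ HasVolume A k ∧ (A + A).card = 3 * k - 3) := by
  subst hk
  obtain ⟨p, q, b, hp, hq, hqp, hb, hiso⟩ := hseg.exists_f2Isomorphic_twoSeg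
  have hcard : A.card = p + q := by rw [hiso.card_eq, card_twoSeg]
  rcases le_or_gt p (b + 1) with hpb | hpb
  · refine Or.inr ⟨p, q, hcard.symm, hq.trans hqp, hq,
      hiso.trans (f2Isomorphic_twoLines hqp hpb), hiso.hasAddDim (hasAddDim_two hp hq hqp hpb),
      ?_, ?_⟩
    · rw [hcard]
      exact hiso.hasVolume (hasVolume_of_long_gap hp hq hqp hpb)
    · rw [hiso.card_add_eq, card_twoSeg_add_of_le_of_le hq hqp hpb, hcard]
  · have hdim := hiso.hasAddDim (hasAddDim_one hq hpb)
    have hvol := hiso.hasVolume (hasVolume_of_short_gap hq hpb)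
    have hadd := hiso.card_add_eq
    rcases le_or_gt q (b + 1) with hqb | hqb
    · rw [card_twoSeg_add_of_lt_of_le hq hpb hqb] at hadd
      have hle := hext.le_of_hasVolume (m := p + q - 1) (b := b + q - 1) hdim hvol
        (by omega) (by omega) (by omega)
      obtain rfl : q = 1 := by omega
      refine Or.inl ⟨b, hb, by omega, ?_, hdim, ?_, by omega⟩
      · rw [hcard]
        exact hiso.trans (f2Isomorphic_reflect p b (by omega))
      · rwa [hcard]
    · rw [card_twoSeg_add_of_lt_of_lt hpb hqb] at hadd
      have hle := hext.le_of_hasVolume (m := p + q - 1) (b := 2 * b) hdim hvol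
        (by omega) (by omega) (by omega)
      omega
end

section
/- (Freiman's 3k−4 theorem.) Let A ⊆ ℤ be a finite set in normal form with k = |A| ≥ 2 and a = max(A). Then |2A| ≥ min{k + a, 3k − 3}. -/
open Pointwise

namespace Freiman

/-- A set of integers in an interval `[m, M]` containing both endpoints and more than half of the
residues modulo `M - m` has a sumset of size at least `|A| + M - m`. -/
lemma card_add_sub_le_card_add_of_dense (A : Finset ℤ) (m M : ℤ) (hm : m ∈ A) (hM : M ∈ A)
    (hlo : ∀ x ∈ A, m ≤ x) (hhi : ∀ x ∈ A, x ≤ M) (hlt : m < M)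
    (hd : M - m ≤ 2 * (A.card : ℤ) - 3) :
    (A.card : ℤ) + (M - m) ≤ ((A + A).card : ℤ) := by
  set L := M - m with hL
  have hLpos : 0 < L := by omega
  have hD : ((A.erase M).card : ℤ) = A.card - 1 := by
    rw [Finset.card_erase_of_mem hM]
    have := Finset.card_pos.2 ⟨M, hM⟩
    omega
  have hcover : ∀ x, 2 * m ≤ x → x < 2 * m + L → x ∈ A + A ∨ x + L ∈ A + A := by
    intro x hx1 hx2
    let f : ℤ → ℤ := fun y => m + (x - y - m) % L
    have hinj : Set.InjOn f (A.erase M : Finset ℤ) := by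
      intro y hy z hz h
      simp only [Finset.coe_erase, Set.mem_sdiff, Finset.mem_coe, Set.mem_singleton_iff] at hy hz
      have h' : (x - y - m) % L = (x - z - m) % L := by simpa [f] using h
      have hdvd : L ∣ (x - z - m) - (x - y - m) := Int.ModEq.dvd h'
      have h1 := hlo y hy.1
      have h2 := hlo z hz.1
      have h3 := lt_of_le_of_ne (hhi y hy.1) hy.2
      have h4 := lt_of_le_of_ne (hhi z hz.1) hz.2
      have h5 : (x - z - m) - (x - y - m) = 0 :=
        Int.eq_zero_of_abs_lt_dvd hdvd (by rw [abs_lt]; constructor <;> omega)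
      omega
    have hnd : ¬ Disjoint (A.erase M) ((A.erase M).image f) := by
      intro hdis
      have hsub : A.erase M ∪ (A.erase M).image f ⊆ Finset.Ico m M := by
        intro y hy
        rw [Finset.mem_union] at hy
        rw [Finset.mem_Ico]
        rcases hy with hy | hy
        · rw [Finset.mem_erase] at hy
          exact ⟨hlo y hy.2, lt_of_le_of_ne (hhi y hy.2) hy.1⟩
        · obtain ⟨z, -, rfl⟩ := Finset.mem_image.1 hy
          have h1 := Int.emod_nonneg (x - z - m) hLpos.ne'
          have h2 := Int.emod_lt_of_pos (x - z - m) hLpos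
          simp only [f]
          omega
      have h := Finset.card_le_card hsub
      rw [Finset.card_union_of_disjoint hdis, Finset.card_image_of_injOn hinj, Int.card_Ico] at h
      omega
    obtain ⟨y, hy, hy'⟩ := Finset.not_disjoint_iff.1 hnd
    obtain ⟨z, hz, hzy⟩ := Finset.mem_image.1 hy'
    rw [Finset.mem_erase] at hy hz
    have h1 := hlo y hy.2
    have h2 := hlo z hz.2
    have h3 := lt_of_le_of_ne (hhi y hy.2) hy.1
    have h4 := lt_of_le_of_ne (hhi z hz.2) hz.1
    have h5 := Int.emod_add_mul_ediv (x - z - m) L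
    simp only [f] at hzy
    have h6 : y + z = x - L * ((x - z - m) / L) := by linarith
    have hq1 : (x - z - m) / L < 1 := by
      by_contra! hq
      nlinarith
    have hq2 : -2 < (x - z - m) / L := by
      by_contra! hq
      nlinarith
    have hq : (x - z - m) / L = 0 ∨ (x - z - m) / L = -1 := by omega
    rcases hq with hq | hq
    · left
      rw [hq] at h6
      rw [show x = y + z by linarith]
      exact Finset.add_mem_add hy.2 hz.2
    · right
      rw [hq] at h6
      rw [show x + L = y + z by linarith]
      exact Finset.add_mem_add hy.2 hz.2
  let I := Finset.Ico (2 * m) (2 * m + L)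
  let U := I.filter (fun x => x ∈ A + A)
  let V := I.filter (fun x => x + L ∈ A + A)
  have hUV : I ⊆ U ∪ V := by
    intro x hx
    have hx' := Finset.mem_Ico.1 hx
    rcases hcover x hx'.1 hx'.2 with h | h
    · exact Finset.mem_union_left _ (Finset.mem_filter.2 ⟨hx, h⟩)
    · exact Finset.mem_union_right _ (Finset.mem_filter.2 ⟨hx, h⟩)
  have hB : (A.erase M).image (fun x => x + m) ⊆ U ∩ V := by
    intro y hy
    obtain ⟨x, hx, rfl⟩ := Finset.mem_image.1 hy
    rw [Finset.mem_erase] at hx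
    have h1 := hlo x hx.2
    have h2 := lt_of_le_of_ne (hhi x hx.2) hx.1
    have hI : x + m ∈ I := Finset.mem_Ico.2 ⟨by omega, by omega⟩
    refine Finset.mem_inter.2 ⟨Finset.mem_filter.2 ⟨hI, Finset.add_mem_add hx.2 hm⟩,
      Finset.mem_filter.2 ⟨hI, ?_⟩⟩
    rw [show x + m + L = x + M by omega]
    exact Finset.add_mem_add hx.2 hM
  have c1 := Finset.card_le_card hUV
  have c2 := Finset.card_le_card hB
  rw [Finset.card_image_of_injective _ (add_left_injective m)] at c2
  have c3 := Finset.card_union_add_card_inter U V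
  have cI : (I.card : ℤ) = L := by
    simp only [I, Int.card_Ico]
    omega
  have hdis : Disjoint U (V.image (fun x => x + L)) := by
    rw [Finset.disjoint_left]
    intro x hx hx'
    obtain ⟨y, hy, rfl⟩ := Finset.mem_image.1 hx'
    have h1 := Finset.mem_Ico.1 (Finset.mem_filter.1 hx).1
    have h2 := Finset.mem_Ico.1 (Finset.mem_filter.1 hy).1
    omega
  have hnot : 2 * M ∉ U ∪ V.image (fun x => x + L) := by
    intro h
    rcases Finset.mem_union.1 h with h | h
    · have h1 := Finset.mem_Ico.1 (Finset.mem_filter.1 h).1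
      omega
    · obtain ⟨y, hy, h⟩ := Finset.mem_image.1 h
      have h2 := Finset.mem_Ico.1 (Finset.mem_filter.1 hy).1
      omega
  have hsub : insert (2 * M) (U ∪ V.image (fun x => x + L)) ⊆ A + A := by
    intro y hy
    rcases Finset.mem_insert.1 hy with rfl | hy
    · rw [two_mul]
      exact Finset.add_mem_add hM hM
    · rcases Finset.mem_union.1 hy with h | h
      · exact (Finset.mem_filter.1 h).2
      · obtain ⟨z, hz, rfl⟩ := Finset.mem_image.1 h
        exact (Finset.mem_filter.1 hz).2
  have c4 := Finset.card_le_card hsub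
  rw [Finset.card_insert_of_notMem hnot, Finset.card_union_of_disjoint hdis,
    Finset.card_image_of_injective _ (add_left_injective L)] at c4
  omega

/-- A set filling more than half of `[m, m + n]` has `2 * m + n` as a sum of two elements. -/
lemma mem_add_of_lt_two_mul_card (C : Finset ℤ) (m n : ℤ) (hlo : ∀ x ∈ C, m ≤ x)
    (hhi : ∀ x ∈ C, x ≤ m + n) (hn : 0 ≤ n) (h : n + 1 < 2 * (C.card : ℤ)) :
    2 * m + n ∈ C + C := by
  have hinj : Function.Injective (fun y : ℤ => 2 * m + n - y) := sub_right_injective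
  have hnd : ¬ Disjoint C (C.image (fun y => 2 * m + n - y)) := by
    intro hdis
    have hsub : C ∪ C.image (fun y => 2 * m + n - y) ⊆ Finset.Icc m (m + n) := by
      intro y hy
      rw [Finset.mem_Icc]
      rcases Finset.mem_union.1 hy with hy | hy
      · exact ⟨hlo y hy, hhi y hy⟩
      · obtain ⟨z, hz, rfl⟩ := Finset.mem_image.1 hy
        have := hlo z hz
        have := hhi z hz
        constructor <;> omega
    have h := Finset.card_le_card hsub
    rw [Finset.card_union_of_disjoint hdis, Finset.card_image_of_injective _ hinj,
      Int.card_Icc] at h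
    omega
  obtain ⟨y, hy, hy'⟩ := Finset.not_disjoint_iff.1 hnd
  obtain ⟨z, hz, hzy⟩ := Finset.mem_image.1 hy'
  rw [show 2 * m + n = y + z by omega]
  exact Finset.add_mem_add hy hz

lemma card_add_card_le_card_add_add_one (s t : Finset ℤ) (hs : s.Nonempty) (ht : t.Nonempty) :
    s.card + t.card ≤ (s + t).card + 1 := by
  have := cauchy_davenport_add_of_linearOrder_isCancelAdd hs ht
  omega

/-- If everything below `u` is congruent to `w` modulo `g` and everything above `v` is congruent to
`w` modulo `e`, while `u` and `v` themselves are not, then `A` behaves like a two-dimensional set. -/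
lemma three_mul_card_le_of_crossing_progressions (A : Finset ℤ) (u v w g e : ℤ) (hu : u ∈ A)
    (hv : v ∈ A) (hw : w ∈ A) (hvw : v < w) (hwu : w < u)
    (hg : ∀ x ∈ A, x < u → g ∣ x - w) (hgu : ¬ g ∣ u - w)
    (he : ∀ x ∈ A, v < x → e ∣ x - w) (hev : ¬ e ∣ v - w) :
    3 * A.card ≤ (A + A).card + 3 := by
  classical
  let P := A.filter (fun x => x ≤ w)
  let Q := A.filter (fun x => w ≤ x)
  let P' := A.filter (fun x => ¬ e ∣ x - w)
  let Q' := A.filter (fun x => ¬ g ∣ x - w)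
  let S := A.filter (fun x => x < w ∧ e ∣ x - w)
  let T := A.filter (fun x => w < x ∧ g ∣ x - w)
  have hP' : ∀ x ∈ P', x ≤ v := fun x hx => by
    obtain ⟨h1, h2⟩ := Finset.mem_filter.1 hx
    by_contra! h
    exact h2 (he x h1 h)
  have hQ' : ∀ x ∈ Q', u ≤ x := fun x hx => by
    obtain ⟨h1, h2⟩ := Finset.mem_filter.1 hx
    by_contra! h
    exact h2 (hg x h1 h)
  have hPS : P = insert w (P' ∪ S) := by
    ext x
    simp only [P, P', S, Finset.mem_filter, Finset.mem_insert, Finset.mem_union]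
    constructor
    · rintro ⟨h1, h2⟩
      rcases h2.eq_or_lt with h | h
      · exact Or.inl h
      · tauto
    · rintro (rfl | h | h)
      · exact ⟨hw, le_rfl⟩
      · exact ⟨h.1, (hP' x (Finset.mem_filter.2 h)).trans hvw.le⟩
      · exact ⟨h.1, h.2.1.le⟩
  have hQT : Q = insert w (Q' ∪ T) := by
    ext x
    simp only [Q, Q', T, Finset.mem_filter, Finset.mem_insert, Finset.mem_union]
    constructor
    · rintro ⟨h1, h2⟩
      rcases h2.eq_or_lt with h | h
      · exact Or.inl h.symm
      · tauto
    · rintro (rfl | h | h)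
      · exact ⟨hw, le_rfl⟩
      · exact ⟨h.1, hwu.le.trans (hQ' x (Finset.mem_filter.2 h))⟩
      · exact ⟨h.1, h.2.1.le⟩
  have cP : P.card = P'.card + S.card + 1 := by
    rw [hPS, Finset.card_insert_of_notMem, Finset.card_union_of_disjoint]
    · rw [Finset.disjoint_left]
      intro x hx hx'
      exact (Finset.mem_filter.1 hx).2 (Finset.mem_filter.1 hx').2.2
    · simp [P', S]
  have cQ : Q.card = Q'.card + T.card + 1 := by
    rw [hQT, Finset.card_insert_of_notMem, Finset.card_union_of_disjoint]
    · rw [Finset.disjoint_left]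
      intro x hx hx'
      exact (Finset.mem_filter.1 hx).2 (Finset.mem_filter.1 hx').2.2
    · simp [Q', T]
  have cA : P.card + Q.card = A.card + 1 := by
    rw [← Finset.card_union_add_card_inter]
    have h1 : P ∪ Q = A := by
      ext x
      simp only [P, Q, Finset.mem_filter, Finset.mem_union]
      have := le_total x w
      tauto
    have h2 : P ∩ Q = {w} := by
      ext x
      simp only [P, Q, Finset.mem_filter, Finset.mem_inter, Finset.mem_singleton]
      constructor
      · rintro ⟨h1, h2⟩
        exact le_antisymm h1.2 h2.2
      · rintro rfl
        exact ⟨⟨hw, le_rfl⟩, hw, le_rfl⟩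
    rw [h1, h2, Finset.card_singleton]
  have hwP : w ∈ P := Finset.mem_filter.2 ⟨hw, le_rfl⟩
  have hwQ : w ∈ Q := Finset.mem_filter.2 ⟨hw, le_rfl⟩
  have hPP := card_add_card_le_card_add_add_one P P ⟨w, hwP⟩ ⟨w, hwP⟩
  have hQQ := card_add_card_le_card_add_add_one Q Q ⟨w, hwQ⟩ ⟨w, hwQ⟩
  have hPQ := card_add_card_le_card_add_add_one P' Q' ⟨v, Finset.mem_filter.2 ⟨hv, hev⟩⟩
    ⟨u, Finset.mem_filter.2 ⟨hu, hgu⟩⟩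
  have hinter : ((P + P) ∩ (Q + Q)).card ≤ 1 := by
    rw [Finset.card_le_one_iff_subset_singleton]
    refine ⟨2 * w, fun x hx => ?_⟩
    obtain ⟨h1, h2⟩ := Finset.mem_inter.1 hx
    obtain ⟨p, hp, q, hq, rfl⟩ := Finset.mem_add.1 h1
    obtain ⟨p', hp', q', hq', h⟩ := Finset.mem_add.1 h2
    simp only [P, Q, Finset.mem_filter] at hp hq hp' hq'
    rw [Finset.mem_singleton]
    omega
  have hgP : ∀ x ∈ P, g ∣ x - w := fun x hx => by
    obtain ⟨h1, h2⟩ := Finset.mem_filter.1 hx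
    exact hg x h1 (by omega)
  have heQ : ∀ x ∈ Q, e ∣ x - w := fun x hx => by
    obtain ⟨h1, h2⟩ := Finset.mem_filter.1 hx
    exact he x h1 (by omega)
  have hgPP : ∀ x ∈ P + P, g ∣ x - 2 * w := fun x hx => by
    obtain ⟨p, hp, q, hq, rfl⟩ := Finset.mem_add.1 hx
    rw [show p + q - 2 * w = (p - w) + (q - w) by ring]
    exact dvd_add (hgP p hp) (hgP q hq)
  have heQQ : ∀ x ∈ Q + Q, e ∣ x - 2 * w := fun x hx => by
    obtain ⟨p, hp, q, hq, rfl⟩ := Finset.mem_add.1 hx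
    rw [show p + q - 2 * w = (p - w) + (q - w) by ring]
    exact dvd_add (heQ p hp) (heQ q hq)
  have hP'P : P' ⊆ P := by
    rw [hPS]
    exact Finset.subset_union_left.trans (Finset.subset_insert _ _)
  have hQ'Q : Q' ⊆ Q := by
    rw [hQT]
    exact Finset.subset_union_left.trans (Finset.subset_insert _ _)
  have hgPQ : ∀ x ∈ P' + Q', ¬ g ∣ x - 2 * w := fun x hx hdvd => by
    obtain ⟨p, hp, q, hq, rfl⟩ := Finset.mem_add.1 hx
    rw [show p + q - 2 * w = (p - w) + (q - w) by ring] at hdvd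
    exact (Finset.mem_filter.1 hq).2 ((dvd_add_right (hgP p (hP'P hp))).1 hdvd)
  have hePQ : ∀ x ∈ P' + Q', ¬ e ∣ x - 2 * w := fun x hx hdvd => by
    obtain ⟨p, hp, q, hq, rfl⟩ := Finset.mem_add.1 hx
    rw [show p + q - 2 * w = (p - w) + (q - w) by ring] at hdvd
    exact (Finset.mem_filter.1 hp).2 ((dvd_add_left (heQ q (hQ'Q hq))).1 hdvd)
  let S' := S.image (fun x => u + x)
  let T' := T.image (fun x => v + x)
  have cS' : S'.card = S.card := Finset.card_image_of_injective _ (add_right_injective u)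
  have cT' : T'.card = T.card := Finset.card_image_of_injective _ (add_right_injective v)
  have hgS : ∀ x ∈ S', ¬ g ∣ x - 2 * w := fun x hx hdvd => by
    obtain ⟨y, hy, rfl⟩ := Finset.mem_image.1 hx
    obtain ⟨h1, h2, h3⟩ := Finset.mem_filter.1 hy
    rw [show u + y - 2 * w = (u - w) + (y - w) by ring] at hdvd
    exact hgu ((dvd_add_left (hg y h1 (by omega))).1 hdvd)
  have heS : ∀ x ∈ S', e ∣ x - 2 * w := fun x hx => by
    obtain ⟨y, hy, rfl⟩ := Finset.mem_image.1 hx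
    obtain ⟨h1, h2, h3⟩ := Finset.mem_filter.1 hy
    rw [show u + y - 2 * w = (u - w) + (y - w) by ring]
    exact dvd_add (he u hu (by omega)) h3
  have heT : ∀ x ∈ T', ¬ e ∣ x - 2 * w := fun x hx hdvd => by
    obtain ⟨y, hy, rfl⟩ := Finset.mem_image.1 hx
    obtain ⟨h1, h2, h3⟩ := Finset.mem_filter.1 hy
    rw [show v + y - 2 * w = (v - w) + (y - w) by ring] at hdvd
    exact hev ((dvd_add_left (he y h1 (by omega))).1 hdvd)
  have hgT : ∀ x ∈ T', g ∣ x - 2 * w := fun x hx => by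
    obtain ⟨y, hy, rfl⟩ := Finset.mem_image.1 hx
    obtain ⟨h1, h2, h3⟩ := Finset.mem_filter.1 hy
    rw [show v + y - 2 * w = (v - w) + (y - w) by ring]
    exact dvd_add (hg v hv (by omega)) h3
  have hSQ : ∀ x ∈ S', x ∉ Q + Q := fun x hx hx' => by
    have hndvd := hgS x hx
    obtain ⟨y, hy, rfl⟩ := Finset.mem_image.1 hx
    obtain ⟨h1, h2, h3⟩ := Finset.mem_filter.1 hy
    obtain ⟨p, hp, q, hq, h⟩ := Finset.mem_add.1 hx'
    obtain ⟨hp1, hp2⟩ := Finset.mem_filter.1 hp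
    obtain ⟨hq1, hq2⟩ := Finset.mem_filter.1 hq
    refine hndvd ?_
    rw [← h, show p + q - 2 * w = (p - w) + (q - w) by ring]
    exact dvd_add (hg p hp1 (by omega)) (hg q hq1 (by omega))
  have hTP : ∀ x ∈ T', x ∉ P + P := fun x hx hx' => by
    have hndvd := heT x hx
    obtain ⟨y, hy, rfl⟩ := Finset.mem_image.1 hx
    obtain ⟨h1, h2, h3⟩ := Finset.mem_filter.1 hy
    obtain ⟨p, hp, q, hq, h⟩ := Finset.mem_add.1 hx'
    obtain ⟨hp1, hp2⟩ := Finset.mem_filter.1 hp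
    obtain ⟨hq1, hq2⟩ := Finset.mem_filter.1 hq
    refine hndvd ?_
    rw [← h, show p + q - 2 * w = (p - w) + (q - w) by ring]
    exact dvd_add (he p hp1 (by omega)) (he q hq1 (by omega))
  have d1 : Disjoint ((P + P) ∪ (Q + Q)) (P' + Q') := by
    rw [Finset.disjoint_left]
    intro x hx hx'
    rcases Finset.mem_union.1 hx with h | h
    · exact hgPQ x hx' (hgPP x h)
    · exact hePQ x hx' (heQQ x h)
  have d2 : Disjoint (((P + P) ∪ (Q + Q)) ∪ (P' + Q')) S' := by
    rw [Finset.disjoint_left]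
    intro x hx hx'
    rcases Finset.mem_union.1 hx with h | h
    · rcases Finset.mem_union.1 h with h | h
      · exact hgS x hx' (hgPP x h)
      · exact hSQ x hx' h
    · exact hePQ x h (heS x hx')
  have d3 : Disjoint ((((P + P) ∪ (Q + Q)) ∪ (P' + Q')) ∪ S') T' := by
    rw [Finset.disjoint_left]
    intro x hx hx'
    rcases Finset.mem_union.1 hx with h | h
    · rcases Finset.mem_union.1 h with h | h
      · rcases Finset.mem_union.1 h with h | h
        · exact hTP x hx' h
        · exact heT x hx' (heQQ x h)
      · exact hgPQ x h (hgT x hx')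
    · exact hgS x h (hgT x hx')
  have hsub : ((((P + P) ∪ (Q + Q)) ∪ (P' + Q')) ∪ S') ∪ T' ⊆ A + A := by
    refine Finset.union_subset (Finset.union_subset (Finset.union_subset (Finset.union_subset
      (Finset.add_subset_add (Finset.filter_subset _ _) (Finset.filter_subset _ _))
      (Finset.add_subset_add (Finset.filter_subset _ _) (Finset.filter_subset _ _)))
      (Finset.add_subset_add (Finset.filter_subset _ _) (Finset.filter_subset _ _))) ?_) ?_
    · intro x hx
      obtain ⟨y, hy, rfl⟩ := Finset.mem_image.1 hx
      exact Finset.add_mem_add hu (Finset.mem_filter.1 hy).1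
    · intro x hx
      obtain ⟨y, hy, rfl⟩ := Finset.mem_image.1 hx
      exact Finset.add_mem_add hv (Finset.mem_filter.1 hy).1
  have key := Finset.card_le_card hsub
  rw [Finset.card_union_of_disjoint d3, Finset.card_union_of_disjoint d2,
    Finset.card_union_of_disjoint d1] at key
  have := Finset.card_union_add_card_inter (P + P) (Q + Q)
  omega

/-- The set of values of `a` on the interval `[l, r]`. -/
noncomputable def seg (a : ℤ → ℤ) (l r : ℤ) : Finset ℤ := (Finset.Icc l r).image a

/-- The values of `a` on `[l, r]` are not contained in a progression of difference `d ≥ 2`. -/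
def Primitive (a : ℤ → ℤ) (l r : ℤ) : Prop :=
  ∀ d : ℤ, 2 ≤ d → ∃ j, l ≤ j ∧ j ≤ r ∧ ¬ d ∣ a j - a l

lemma mem_seg {a : ℤ → ℤ} {l r x : ℤ} : x ∈ seg a l r ↔ ∃ j, (l ≤ j ∧ j ≤ r) ∧ a j = x := by
  simp [seg]

lemma apply_mem_seg {a : ℤ → ℤ} {l r j : ℤ} (h1 : l ≤ j) (h2 : j ≤ r) : a j ∈ seg a l r :=
  mem_seg.2 ⟨j, ⟨h1, h2⟩, rfl⟩

lemma seg_subset_seg {a : ℤ → ℤ} {l r l' r' : ℤ} (h1 : l ≤ l') (h2 : r' ≤ r) :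
    seg a l' r' ⊆ seg a l r :=
  Finset.image_subset_image (Finset.Icc_subset_Icc h1 h2)

lemma card_seg {a : ℤ → ℤ} (ha : StrictMono a) {l r : ℤ} (h : l ≤ r) :
    ((seg a l r).card : ℤ) = r - l + 1 := by
  rw [seg, Finset.card_image_of_injective _ ha.injective, Int.card_Icc]
  omega

lemma sub_le_apply_sub {a : ℤ → ℤ} (ha : StrictMono a) {i j : ℤ} (h : i ≤ j) :
    j - i ≤ a j - a i := by
  induction j, h using Int.leInduction with
  | base => simp
  | succ n hn ih =>
    have := ha (show n < n + 1 by omega)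
    omega

/-- Sumset bounds for two segments overlapping in two consecutive elements can be combined. -/
lemma card_add_card_seg_le_glue {a : ℤ → ℤ} (ha : StrictMono a) {l r i : ℤ} (hli : l ≤ i)
    (hir : i + 1 ≤ r) :
    (seg a l (i + 1) + seg a l (i + 1)).card + (seg a i r + seg a i r).card ≤
      (seg a l r + seg a l r).card + 3 := by
  set X := seg a l (i + 1)
  set Y := seg a i r
  have hinter : (X + X) ∩ (Y + Y) ⊆ {2 * a i, a i + a (i + 1), 2 * a (i + 1)} := by
    intro x hx
    obtain ⟨h1, h2⟩ := Finset.mem_inter.1 hx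
    obtain ⟨_, hp, _, hq, rfl⟩ := Finset.mem_add.1 h1
    obtain ⟨_, hs, _, ht, h⟩ := Finset.mem_add.1 h2
    obtain ⟨p, hp', rfl⟩ := mem_seg.1 hp
    obtain ⟨q, hq', rfl⟩ := mem_seg.1 hq
    obtain ⟨s, hs', rfl⟩ := mem_seg.1 hs
    obtain ⟨t, ht', rfl⟩ := mem_seg.1 ht
    have up : ∀ j, j ≤ i + 1 → a j = a (i + 1) ∨ a j ≤ a i := fun j hj => by
      rcases hj.eq_or_lt with rfl | hj
      · exact Or.inl rfl
      · exact Or.inr (ha.monotone (by omega))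
    have down : ∀ j, i ≤ j → a j = a i ∨ a (i + 1) ≤ a j := fun j hj => by
      rcases hj.eq_or_lt with rfl | hj
      · exact Or.inl rfl
      · exact Or.inr (ha.monotone (by omega))
    have := ha (show i < i + 1 by omega)
    have := up p hp'.2
    have := up q hq'.2
    have := down s hs'.1
    have := down t ht'.1
    simp only [Finset.mem_insert, Finset.mem_singleton]
    omega
  have c1 := (Finset.card_le_card hinter).trans Finset.card_le_three
  have hsub : (X + X) ∪ (Y + Y) ⊆ seg a l r + seg a l r :=
    Finset.union_subset
      (Finset.add_subset_add (seg_subset_seg le_rfl hir) (seg_subset_seg le_rfl hir))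
      (Finset.add_subset_add (seg_subset_seg hli le_rfl) (seg_subset_seg hli le_rfl))
  have c2 := Finset.card_le_card hsub
  have := Finset.card_union_add_card_inter (X + X) (Y + Y)
  omega

lemma three_mul_le_card_of_short {a : ℤ → ℤ} (ha : StrictMono a) {l r : ℤ} (hlr : l < r)
    (h : a r - a l = 2 * (r - l) - 1) : 3 * (r - l) ≤ (seg a l r + seg a l r).card := by
  have hc := card_seg ha hlr.le
  have := card_add_sub_le_card_add_of_dense (seg a l r) (a l) (a r)
    (apply_mem_seg le_rfl hlr.le) (apply_mem_seg hlr.le le_rfl)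
    (fun x hx => by
      obtain ⟨j, hj, rfl⟩ := mem_seg.1 hx
      exact ha.monotone hj.1)
    (fun x hx => by
      obtain ⟨j, hj, rfl⟩ := mem_seg.1 hx
      exact ha.monotone hj.2) (ha hlr) (by omega)
  omega

lemma mem_seg_add_seg_of_dense {a : ℤ → ℤ} (ha : StrictMono a) {l s : ℤ}
    (hlow : ∀ j, l < j → j ≤ s → a j - a l ≤ 2 * (j - l) - 1) {n : ℤ} (hn : 0 ≤ n)
    (hns : n ≤ 2 * (s - l)) : 2 * a l + n ∈ seg a l s + seg a l s := by
  obtain ⟨j, hj1, hj2⟩ : ∃ j, n ≤ 2 * (j - l) ∧ 2 * (j - l) ≤ n + 1 :=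
    ⟨l + (n + 1) / 2, by omega, by omega⟩
  have hlj : l ≤ j := by omega
  have hjs : j ≤ s := by omega
  have hjn : a j ≤ a l + n := by
    rcases hlj.eq_or_lt with rfl | hlj
    · omega
    · have := hlow j hlj hjs
      omega
  have hc := card_seg ha hlj
  refine Finset.add_subset_add (seg_subset_seg le_rfl hjs) (seg_subset_seg le_rfl hjs)
    (mem_add_of_lt_two_mul_card (seg a l j) (a l) n ?_ ?_ hn (by omega))
  · intro x hx
    obtain ⟨i, hi, rfl⟩ := mem_seg.1 hx
    exact ha.monotone hi.1
  · intro x hx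
    obtain ⟨i, hi, rfl⟩ := mem_seg.1 hx
    exact (ha.monotone hi.2).trans hjn

/-- A dense initial part followed by a part with all gaps at least two. -/
lemma three_mul_le_card_of_dense_of_gaps {a : ℤ → ℤ} (ha : StrictMono a) {l t r : ℤ}
    (hlt : l + 2 ≤ t) (htr : t ≤ r)
    (hlow : ∀ j, l < j → j < t → a j - a l ≤ 2 * (j - l) - 1)
    (hhigh : 2 * (t - l) ≤ a t - a l) (hgap : ∀ j, t ≤ j → j < r → a j + 2 ≤ a (j + 1)) :
    3 * (r - l) ≤ (seg a l r + seg a l r).card := by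
  have hone : a (l + 1) = a l + 1 := by
    have := hlow (l + 1) (by omega) (by omega)
    have := ha (show l < l + 1 by omega)
    omega
  let I := Finset.Icc (2 * a l) (2 * a l + 2 * (t - 1 - l))
  let J := (Finset.Ico t r).image (fun j => a l + a j)
  let K := (Finset.Ico t r).image (fun j => a (l + 1) + a j)
  let R := (Finset.Icc l r).image (fun j => a r + a j)
  have inj : ∀ c, Function.Injective (fun j => c + a j) := fun c x y h =>
    ha.injective (add_left_cancel h)
  have cI : (I.card : ℤ) = 2 * (t - l) - 1 := by
    simp only [I, Int.card_Icc]
    omega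
  have cJ : (J.card : ℤ) = r - t := by
    simp only [J]
    rw [Finset.card_image_of_injective _ (inj _), Int.card_Ico]
    omega
  have cK : (K.card : ℤ) = r - t := by
    simp only [K]
    rw [Finset.card_image_of_injective _ (inj _), Int.card_Ico]
    omega
  have cR : (R.card : ℤ) = r - l + 1 := by
    simp only [R]
    rw [Finset.card_image_of_injective _ (inj _), Int.card_Icc]
    omega
  have hbelow : ∀ j, t ≤ j → j < r → a j + 2 ≤ a r := fun j h1 h2 =>
    (hgap j h1 h2).trans (ha.monotone (by omega))
  have dJK : Disjoint J K := by
    rw [Finset.disjoint_left]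
    intro x hx hx'
    obtain ⟨p, hp, rfl⟩ := Finset.mem_image.1 hx
    obtain ⟨q, hq, h⟩ := Finset.mem_image.1 hx'
    rw [Finset.mem_Ico] at hp hq
    have hqp : q < p := by
      by_contra! hpq
      have := ha.monotone hpq
      omega
    have := hgap q hq.1 hq.2
    have := ha.monotone (show q + 1 ≤ p by omega)
    omega
  have dI : Disjoint I (J ∪ K) := by
    rw [Finset.disjoint_left]
    intro x hx hx'
    rw [Finset.mem_Icc] at hx
    rcases Finset.mem_union.1 hx' with h | h
    all_goals
      obtain ⟨p, hp, rfl⟩ := Finset.mem_image.1 h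
      rw [Finset.mem_Ico] at hp
      have := ha.monotone hp.1
      omega
  have dR : Disjoint (I ∪ (J ∪ K)) R := by
    rw [Finset.disjoint_left]
    intro x hx hx'
    obtain ⟨q, hq, rfl⟩ := Finset.mem_image.1 hx'
    rw [Finset.mem_Icc] at hq
    have hlq := ha.monotone hq.1
    rcases Finset.mem_union.1 hx with h | h
    · rw [Finset.mem_Icc] at h
      have := ha.monotone htr
      omega
    · rcases Finset.mem_union.1 h with h | h
      all_goals
        obtain ⟨p, hp, h⟩ := Finset.mem_image.1 h
        rw [Finset.mem_Ico] at hp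
        have := hbelow p hp.1 hp.2
        omega
  have hsub : (I ∪ (J ∪ K)) ∪ R ⊆ seg a l r + seg a l r := by
    refine Finset.union_subset (Finset.union_subset ?_ (Finset.union_subset ?_ ?_)) ?_
    · intro x hx
      rw [Finset.mem_Icc] at hx
      have := mem_seg_add_seg_of_dense ha (l := l) (s := t - 1)
        (fun j h1 h2 => hlow j h1 (by omega)) (n := x - 2 * a l) (by omega) (by omega)
      rw [show 2 * a l + (x - 2 * a l) = x by ring] at this
      exact Finset.add_subset_add (seg_subset_seg le_rfl (by omega))
        (seg_subset_seg le_rfl (by omega)) this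
    all_goals
      intro x hx
      obtain ⟨p, hp, rfl⟩ := Finset.mem_image.1 hx
      simp only [Finset.mem_Ico, Finset.mem_Icc] at hp
      exact Finset.add_mem_add (apply_mem_seg (by omega) (by omega))
        (apply_mem_seg (by omega) (by omega))
  have key := Finset.card_le_card hsub
  rw [Finset.card_union_of_disjoint dR, Finset.card_union_of_disjoint dI,
    Finset.card_union_of_disjoint dJK] at key
  omega

/-- A progression together with one larger element outside of it. -/
lemma three_mul_le_card_of_dvd_of_not_dvd {a : ℤ → ℤ} (ha : StrictMono a) {l i g : ℤ}
    (hli : l ≤ i) (hdvd : ∀ j, l ≤ j → j ≤ i → g ∣ a j - a l) (hnd : ¬ g ∣ a (i + 1) - a l) :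
    3 * (i + 1 - l) ≤ (seg a l (i + 1) + seg a l (i + 1)).card := by
  set X := seg a l i
  have hX : X ⊆ seg a l (i + 1) := seg_subset_seg le_rfl (by omega)
  have hlast : a (i + 1) ∈ seg a l (i + 1) := apply_mem_seg (by omega) le_rfl
  have hne : X.Nonempty := ⟨a l, apply_mem_seg le_rfl hli⟩
  have c1 := card_add_card_le_card_add_add_one X X hne hne
  have c2 : (X.card : ℤ) = i - l + 1 := card_seg ha hli
  let Y := X.image (fun x => a (i + 1) + x)
  have cY : Y.card = X.card := Finset.card_image_of_injective _ (add_right_injective _)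
  have hmod : ∀ x ∈ X, g ∣ x - a l := fun x hx => by
    obtain ⟨j, hj, rfl⟩ := mem_seg.1 hx
    exact hdvd j hj.1 hj.2
  have hlt : ∀ x ∈ X, x < a (i + 1) := fun x hx => by
    obtain ⟨j, hj, rfl⟩ := mem_seg.1 hx
    exact ha (by omega)
  have d1 : Disjoint (X + X) Y := by
    rw [Finset.disjoint_left]
    intro x hx hx'
    obtain ⟨p, hp, q, hq, rfl⟩ := Finset.mem_add.1 hx
    obtain ⟨s, hs, h⟩ := Finset.mem_image.1 hx'
    apply hnd
    rw [show a (i + 1) - a l = (p - a l) + (q - a l) - (s - a l) by linarith]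
    exact dvd_sub (dvd_add (hmod p hp) (hmod q hq)) (hmod s hs)
  have hnot : 2 * a (i + 1) ∉ (X + X) ∪ Y := by
    intro h
    rcases Finset.mem_union.1 h with h | h
    · obtain ⟨p, hp, q, hq, h⟩ := Finset.mem_add.1 h
      have := hlt p hp
      have := hlt q hq
      omega
    · obtain ⟨p, hp, h⟩ := Finset.mem_image.1 h
      have := hlt p hp
      omega
  have hsub : insert (2 * a (i + 1)) ((X + X) ∪ Y) ⊆ seg a l (i + 1) + seg a l (i + 1) := by
    refine Finset.insert_subset ?_ (Finset.union_subset (Finset.add_subset_add hX hX) ?_)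
    · rw [two_mul]
      exact Finset.add_mem_add hlast hlast
    · intro x hx
      obtain ⟨p, hp, rfl⟩ := Finset.mem_image.1 hx
      exact Finset.add_mem_add hlast (hX hp)
  have key := Finset.card_le_card hsub
  rw [Finset.card_insert_of_notMem hnot, Finset.card_union_of_disjoint d1] at key
  omega

lemma primitive_of_succ {a : ℤ → ℤ} {l r i : ℤ} (hli : l ≤ i) (hir : i + 1 ≤ r)
    (h : a (i + 1) = a i + 1) : Primitive a l r := by
  intro d hd
  by_contra! hall
  have h1 := hall i hli (by omega)
  have h2 := hall (i + 1) (by omega) hir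
  have h3 : d ∣ 1 := by
    have := dvd_sub h2 h1
    rwa [h, show a i + 1 - a l - (a i - a l) = 1 by ring] at this
  have := Int.le_of_dvd one_pos h3
  omega

/-- The first index after `l` satisfying `p`. -/
lemma exists_first_index {p : ℤ → Prop} {l r : ℤ} (hlr : l < r) (hr : p r) :
    ∃ t, l < t ∧ t ≤ r ∧ p t ∧ ∀ j, l < j → j < t → ¬ p j := by
  classical
  obtain ⟨t, ⟨h1, h2⟩, h3⟩ := Int.exists_least_of_bdd (P := fun j => l < j ∧ p j)
    ⟨l, fun z hz => hz.1.le⟩ ⟨r, hlr, hr⟩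
  refine ⟨t, h1, h3 r ⟨hlr, hr⟩, h2, fun j hj1 hj2 hj => ?_⟩
  have := h3 j ⟨hj1, hj⟩
  omega

/-- Under the induction hypothesis for shorter segments, either the desired bound holds or every
initial segment has length at least twice its number of gaps. -/
lemma three_mul_le_card_or_sparse {a : ℤ → ℤ} (ha : StrictMono a) {l r : ℤ} (hlr : l < r)
    (hlen : 2 * (r - l) ≤ a r - a l)
    (ih : ∀ l' r', l' < r' → r' - l' < r - l → Primitive a l' r' →
      2 * (r' - l') - 1 ≤ a r' - a l' → 3 * (r' - l') ≤ (seg a l' r' + seg a l' r').card) :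
    3 * (r - l) ≤ (seg a l r + seg a l r).card ∨
      ∀ j, l ≤ j → j ≤ r → 2 * (j - l) ≤ a j - a l := by
  by_cases hone : a (l + 1) - a l ≤ 1
  · left
    have h1 : a (l + 1) = a l + 1 := by
      have := ha (show l < l + 1 by omega)
      omega
    obtain ⟨t, ht1, ht2, ht3, ht4⟩ :=
      exists_first_index (p := fun j => 2 * (j - l) ≤ a j - a l) hlr hlen
    have hlt : l + 2 ≤ t := by
      rcases (show l + 1 ≤ t by omega).eq_or_lt with rfl | h
      · omega
      · omega
    have hlow : ∀ j, l < j → j < t → a j - a l ≤ 2 * (j - l) - 1 := fun j hj1 hj2 => by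
      have := ht4 j hj1 hj2
      omega
    by_cases hprim : t < r ∧ Primitive a (t - 1) r
    · have hlow' := hlow (t - 1) (by omega) (by omega)
      have g1 := ih l t (by omega) (by omega) (primitive_of_succ le_rfl (by omega) h1) (by omega)
      have g2 := ih (t - 1) r (by omega) (by omega) hprim.2 (by omega)
      have := card_add_card_seg_le_glue ha (l := l) (r := r) (i := t - 1) (by omega) (by omega)
      rw [sub_add_cancel] at this
      omega
    · refine three_mul_le_card_of_dense_of_gaps ha hlt ht2 hlow ht3 fun j hj1 hj2 => ?_
      by_contra! hgap
      have := ha (show j < j + 1 by omega)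
      exact hprim ⟨by omega, primitive_of_succ (i := j) (by omega) (by omega) (by omega)⟩
  · by_cases hdown : ∀ j, l + 1 ≤ j → j < r → 2 * (j - l) ≤ a j - a l
    · right
      intro j hj1 hj2
      rcases hj1.eq_or_lt with rfl | hj1
      · omega
      rcases hj2.eq_or_lt with rfl | hj2
      · exact hlen
      · exact hdown j (by omega) hj2
    · left
      push Not at hdown
      obtain ⟨s, hs1, hs2, hs3⟩ := hdown
      have hs4 : l + 1 < s := by
        rcases hs1.eq_or_lt with rfl | h
        · omega
        · exact h
      obtain ⟨t, ht1, ht2, ht3, ht4⟩ :=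
        exists_first_index (p := fun j => a j - a l < 2 * (j - l)) hs4 hs3
      have hprev : 2 * (t - 1 - l) ≤ a (t - 1) - a l := by
        rcases (show l + 1 ≤ t - 1 by omega).eq_or_lt with h | h
        · rw [← h]
          omega
        · have := ht4 (t - 1) h (by omega)
          omega
      have hstep := ha (show t - 1 < t by omega)
      have g1 := three_mul_le_card_of_short ha (l := l) (r := t) (by omega) (by omega)
      have g2 := ih (t - 1) r (by omega) (by omega)
        (primitive_of_succ (i := t - 1) le_rfl (by omega) (by rw [sub_add_cancel]; omega))
        (by omega)
      have := card_add_card_seg_le_glue ha (l := l) (r := r) (i := t - 1) (by omega) (by omega)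
      rw [sub_add_cancel] at this
      omega

lemma strictMono_reflect {a : ℤ → ℤ} (ha : StrictMono a) : StrictMono (fun j => -a (-j)) :=
  fun x y h => by
    have := ha (show -y < -x by omega)
    simp only
    omega

lemma card_seg_reflect (a : ℤ → ℤ) (l r : ℤ) :
    (seg (fun j => -a (-j)) l r + seg (fun j => -a (-j)) l r).card =
      (seg a (-r) (-l) + seg a (-r) (-l)).card := by
  have h : seg (fun j => -a (-j)) l r = -seg a (-r) (-l) := by
    ext x
    rw [Finset.mem_neg']
    simp only [mem_seg]
    constructor
    · rintro ⟨j, hj, rfl⟩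
      exact ⟨-j, by omega, by omega⟩
    · rintro ⟨j, hj, h⟩
      refine ⟨-j, by omega, ?_⟩
      rw [neg_neg]
      omega
  rw [h, ← neg_add, Finset.card_neg]

lemma primitive_reflect {a : ℤ → ℤ} {l r : ℤ} (hlr : l ≤ r)
    (h : Primitive (fun j => -a (-j)) l r) : Primitive a (-r) (-l) := by
  intro d hd
  by_contra! hall
  obtain ⟨j, hj1, hj2, hj⟩ := h d hd
  apply hj
  have h1 := hall (-j) (by omega) (by omega)
  have h2 := hall (-l) (by omega) (by omega)
  have h3 := dvd_sub h2 h1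
  rwa [show a (-l) - a (-r) - (a (-j) - a (-r)) = -a (-j) - -a (-l) by ring] at h3

/-- A primitive segment of `n + 1` integers of length at least `2 * n - 1` has a sumset of size at
least `3 * n`. -/
theorem three_mul_le_card_of_primitive {a : ℤ → ℤ} (ha : StrictMono a) {l r : ℤ} (hlr : l < r)
    (hprim : Primitive a l r) (hlen : 2 * (r - l) - 1 ≤ a r - a l) :
    3 * (r - l) ≤ (seg a l r + seg a l r).card := by
  obtain ⟨N, hN⟩ : ∃ N : ℕ, r - l = N := ⟨(r - l).toNat, by omega⟩
  induction N using Nat.strong_induction_on generalizing l r with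
  | _ N ihN =>
    have ih : ∀ l' r', l' < r' → r' - l' < r - l → Primitive a l' r' →
        2 * (r' - l') - 1 ≤ a r' - a l' → 3 * (r' - l') ≤ (seg a l' r' + seg a l' r').card :=
      fun l' r' h1 h2 h3 h4 => ihN (r' - l').toNat (by omega) h1 h3 h4 (by omega)
    rcases hlen.eq_or_lt with hlen | hlen
    · exact three_mul_le_card_of_short ha hlr hlen.symm
    rcases three_mul_le_card_or_sparse ha hlr (by omega) ih with h | hsparse
    · exact h
    have hrefl := three_mul_le_card_or_sparse (strictMono_reflect ha) (l := -r) (r := -l)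
      (by omega) (by simp only [neg_neg]; omega) (fun l' r' h1 h2 h3 h4 => by
        rw [card_seg_reflect]
        have := ih (-r') (-l') (by omega) (by omega) (primitive_reflect h1.le h3) (by omega)
        omega)
    rw [card_seg_reflect, neg_neg, neg_neg] at hrefl
    rcases hrefl with h | hsparse'
    · omega
    have hg := hsparse (l + 1) (by omega) (by omega)
    obtain ⟨s, hs1, hs2, hs3⟩ := hprim (a (l + 1) - a l) (by omega)
    have hs4 : l < s := by
      rcases hs1.eq_or_lt with rfl | h
      · simp at hs3
      · exact h
    obtain ⟨t, ht1, ht2, ht3, ht4⟩ :=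
      exists_first_index (p := fun j => ¬ a (l + 1) - a l ∣ a j - a l) hs4 hs3
    obtain ⟨i, rfl⟩ : ∃ i, t = i + 1 := ⟨t - 1, by omega⟩
    have hil : l + 1 ≤ i := by
      by_contra! h
      obtain rfl : i = l := by omega
      exact ht3 dvd_rfl
    have hdvd : ∀ j, l ≤ j → j ≤ i → a (l + 1) - a l ∣ a j - a l := fun j hj1 hj2 => by
      rcases hj1.eq_or_lt with rfl | hj1
      · simp
      · exact not_not.1 (ht4 j hj1 (by omega))
    have g1 := three_mul_le_card_of_dvd_of_not_dvd ha (by omega) hdvd ht3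
    by_cases hpr : Primitive a i r
    · have hi := hsparse' (-i) (by omega) (by omega)
      simp only [neg_neg] at hi
      have g2 := ih i r (by omega) (by omega) hpr (by omega)
      have := card_add_card_seg_le_glue ha (l := l) (r := r) (i := i) (by omega) (by omega)
      omega
    · unfold Primitive at hpr
      push Not at hpr
      obtain ⟨e, he2, he⟩ := hpr
      obtain ⟨s', hs1', hs2', hs3'⟩ : ∃ j, l ≤ j ∧ j ≤ r ∧ ¬ e ∣ a j - a i := by
        by_contra! hall
        obtain ⟨j, hj1, hj2, hj⟩ := hprim e he2
        have := dvd_sub (hall j hj1 hj2) (hall l le_rfl hlr.le)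
        rw [sub_sub_sub_cancel_right] at this
        exact hj this
      have hsi : s' < i := by
        by_contra! h
        exact hs3' (he s' h hs2')
      obtain ⟨v', hv1, hv2, hv3, hv4⟩ :=
        exists_first_index (p := fun j => ¬ e ∣ a (-j) - a i) (l := -i) (r := -s') (by omega)
          (by rwa [neg_neg])
      have hcross := three_mul_card_le_of_crossing_progressions (seg a l r) (a (i + 1))
        (a (-v')) (a i) (a (l + 1) - a l) e (apply_mem_seg (by omega) (by omega))
        (apply_mem_seg (by omega) (by omega)) (apply_mem_seg (by omega) (by omega))
        (ha (by omega)) (ha (by omega))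
        (fun x hx hlt => by
          obtain ⟨j, hj, rfl⟩ := mem_seg.1 hx
          have hj' := ha.lt_iff_lt.1 hlt
          have := dvd_sub (hdvd j hj.1 (by omega)) (hdvd i (by omega) le_rfl)
          rwa [sub_sub_sub_cancel_right] at this)
        (fun h => ht3 (by
          have := dvd_add h (hdvd i (by omega) le_rfl)
          rwa [sub_add_sub_cancel] at this))
        (fun x hx hlt => by
          obtain ⟨j, hj, rfl⟩ := mem_seg.1 hx
          have hj' := ha.lt_iff_lt.1 hlt
          by_cases hij : i ≤ j
          · exact he j hij hj.2
          · have := hv4 (-j) (by omega) (by omega)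
            rw [neg_neg] at this
            exact not_not.1 this)
        hv3
      have hc := card_seg ha hlr.le
      omega

lemma exists_strictMono_seg_eq (A : Finset ℤ) (hA : A.Nonempty) :
    ∃ a : ℤ → ℤ, StrictMono a ∧ ∃ n : ℤ, 0 ≤ n ∧ A = seg a 0 n := by
  induction A using Finset.induction_on_max with
  | empty => simp at hA
  | insert M s hM ih =>
    rcases s.eq_empty_or_nonempty with rfl | hs
    · exact ⟨fun j => M + j, fun x y h => by simpa using h, 0, le_rfl, by simp [seg]⟩
    · obtain ⟨a, ha, n, hn, rfl⟩ := ih hs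
      have hnM : a n < M := hM _ (apply_mem_seg hn le_rfl)
      refine ⟨fun j => if j ≤ n then a j else M + (j - n - 1), ?_, n + 1, by omega, ?_⟩
      · intro x y hxy
        simp only
        have hx : x ≤ n → a x ≤ a n := fun h => ha.monotone h
        have := ha hxy
        split_ifs with h1 h2 h2
        · exact this
        · have := hx h1
          omega
        · omega
        · omega
      · ext x
        simp only [Finset.mem_insert, mem_seg]
        constructor
        · rintro (rfl | ⟨j, hj, rfl⟩)
          · exact ⟨n + 1, by omega, by simp⟩
          · exact ⟨j, by omega, if_pos hj.2⟩
        · rintro ⟨j, hj, rfl⟩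
          split_ifs with h
          · exact Or.inr ⟨j, ⟨hj.1, h⟩, rfl⟩
          · left
            omega

end Freiman

/-- Theorem 4.1 (Freiman's 3k-4 theorem): for `A ⊆ ℤ` in normal form with `k = |A| ≥ 2`
and `a = max A`, we have `|2A| ≥ min (k + a) (3k - 3)`. -/
theorem freiman_3k4 (A : Finset ℤ) (hA : A.Nonempty) (hcard : 2 ≤ A.card)
    (hmin : A.min' hA = 0) (hgcd : A.gcd id = 1) :
    min ((A.card : ℤ) + A.max' hA) (3 * (A.card : ℤ) - 3) ≤ ((A + A).card : ℤ) := by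
  obtain ⟨a, ha, n, hn, rfl⟩ := Freiman.exists_strictMono_seg_eq A hA
  have hc := Freiman.card_seg ha hn
  have hmin' : (Freiman.seg a 0 n).min' hA = a 0 :=
    le_antisymm (Finset.min'_le _ _ (Freiman.apply_mem_seg le_rfl hn))
      (Finset.le_min' _ _ _ fun x hx => by
        obtain ⟨j, hj, rfl⟩ := Freiman.mem_seg.1 hx
        exact ha.monotone hj.1)
  have hmax : (Freiman.seg a 0 n).max' hA = a n :=
    le_antisymm (Finset.max'_le _ _ _ fun x hx => by
        obtain ⟨j, hj, rfl⟩ := Freiman.mem_seg.1 hx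
        exact ha.monotone hj.2)
      (Finset.le_max' _ _ (Freiman.apply_mem_seg hn le_rfl))
  have h0 : a 0 = 0 := by rw [← hmin', hmin]
  have hnpos : 0 < n := by omega
  rw [hmax]
  rcases le_total (a n) (2 * n - 1) with h | h
  · refine (min_le_left _ _).trans ?_
    have := Freiman.card_add_sub_le_card_add_of_dense (Freiman.seg a 0 n) (a 0) (a n)
      (Freiman.apply_mem_seg le_rfl hn) (Freiman.apply_mem_seg hn le_rfl)
      (fun x hx => hmin' ▸ Finset.min'_le _ _ hx) (fun x hx => hmax ▸ Finset.le_max' _ _ hx)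
      (ha hnpos) (by omega)
    omega
  · refine (min_le_right _ _).trans ?_
    have hprim : Freiman.Primitive a 0 n := by
      intro d hd
      by_contra! hall
      have hdvd : d ∣ (Freiman.seg a 0 n).gcd id := Finset.dvd_gcd fun x hx => by
        obtain ⟨j, hj, rfl⟩ := Freiman.mem_seg.1 hx
        simpa [h0] using hall j hj.1 hj.2
      rw [hgcd] at hdvd
      have := Int.le_of_dvd one_pos hdvd
      omega
    have := Freiman.three_mul_le_card_of_primitive ha hnpos hprim (by omega)
    omega
end
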